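/- Let u, p be a smooth solution of -Δu + u·∇u = -∇p, div u = 0 in ℝ³. Let q > 3, 3 ≤ ℓ ≤ ∞ (or q = ℓ = 3), and define M(R) = R^{2/3 - 3/q} ‖u‖_{L^{q,ℓ}(B(R)\B(R/2))}. If liminf_{R→∞} M(R) < ∞, then the Dirichlet energy D(u) = ∫_{ℝ³} |∇u|² dx is finite and satisfies D(u) ≤ c(q,ℓ) liminf_{R→∞} M(R)³. -/

import Mathlib

open MeasureTheory Metric Filter ENNReal

noncomputable section

abbrev E3 := EuclideanSpace ℝ (Fin 3)

/-- Lorentz quasinorm on a set `Ω` (with `ℓ = ∞` giving the weak norm). -/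
noncomputable def lorentzNorm {α F : Type*} [MeasurableSpace α] [NormedAddCommGroup F]
    (μ : Measure α) (p ℓ : ℝ≥0∞) (f : α → F) (Ω : Set α) : ℝ≥0∞ :=
  if ℓ = ⊤ then
    ⨆ σ : NNReal, (σ : ℝ≥0∞) * (μ {x | x ∈ Ω ∧ (σ : ℝ) < ‖f x‖}) ^ (1 / p).toReal
  else
    (∫⁻ σ in Set.Ioi (0 : ℝ),
        ENNReal.ofReal (σ ^ (ℓ.toReal - 1)) *
          (μ {x | x ∈ Ω ∧ σ < ‖f x‖}) ^ (ℓ / p).toReal) ^ (1 / ℓ).toReal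

/-- The annulus `B(R) \ B(R/2)` centered at the origin in `ℝ³`. -/
def ann (R : ℝ) : Set E3 := Metric.ball (0 : E3) R \ Metric.ball (0 : E3) (R / 2)

/-- Divergence of a vector field on `ℝ³`. -/
noncomputable def divg (u : E3 → E3) (x : E3) : ℝ :=
  ∑ i, fderiv ℝ u x (EuclideanSpace.single i 1) i

/-- Componentwise Laplacian of a vector field on `ℝ³`. -/
noncomputable def lap (u : E3 → E3) (x : E3) : E3 :=
  ∑ i, fderiv ℝ (fun y => fderiv ℝ u y (EuclideanSpace.single i 1)) x (EuclideanSpace.single i 1)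

/-- Convective term `(u · ∇) u`. -/
noncomputable def conv (u : E3 → E3) (x : E3) : E3 := fderiv ℝ u x (u x)

/-- Gradient of a scalar function on `ℝ³`. -/
noncomputable def gradp (p : E3 → ℝ) (x : E3) : E3 :=
  ∑ i, fderiv ℝ p x (EuclideanSpace.single i 1) • EuclideanSpace.single i 1

/-- The steady Navier–Stokes system `-Δu + (u·∇)u + ∇p = 0`, `div u = 0`. -/
def SteadyNS (u : E3 → E3) (p : E3 → ℝ) : Prop :=
  (∀ x, -lap u x + conv u x + gradp p x = 0) ∧ (∀ x, divg u x = 0)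

open scoped ContDiff Pointwise

/-- Partial derivative of a scalar function on `ℝ³`. -/
def pd (i : Fin 3) (h : E3 → ℝ) (x : E3) : ℝ := fderiv ℝ h x (EuclideanSpace.single i 1)

/-- Laplacian of a scalar function on `ℝ³`. -/
def slap (h : E3 → ℝ) (x : E3) : ℝ := ∑ m, pd m (pd m h) x

/-- Smooth compactly supported functions. -/
structure IsTest {F : Type*} [NormedAddCommGroup F] [NormedSpace ℝ F] (h : E3 → F) : Prop where
  smooth : ContDiff ℝ ∞ h
  supp : HasCompactSupport h

@[fun_prop]
lemma contDiff_pd {i : Fin 3} {h : E3 → ℝ} (hh : ContDiff ℝ ∞ h) : ContDiff ℝ ∞ (pd i h) :=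
  (hh.fderiv_right (m := ∞) (by simp)).clm_apply contDiff_const

@[fun_prop]
lemma contDiff_slap {h : E3 → ℝ} (hh : ContDiff ℝ ∞ h) : ContDiff ℝ ∞ (slap h) := by
  unfold slap
  exact ContDiff.sum fun m _ => contDiff_pd (contDiff_pd hh)

lemma ContDiff.diff_top {F : Type*} [NormedAddCommGroup F] [NormedSpace ℝ F] {h : E3 → F}
    (hh : ContDiff ℝ ∞ h) : Differentiable ℝ h := hh.differentiable (by simp)

namespace IsTest

variable {F : Type*} [NormedAddCommGroup F] [NormedSpace ℝ F] {h : E3 → F} {f g : E3 → ℝ}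

lemma fderiv (hh : IsTest h) : IsTest (_root_.fderiv ℝ h) :=
  ⟨hh.smooth.fderiv_right (m := ∞) (by simp), hh.supp.fderiv ℝ⟩

lemma pd (hf : IsTest f) (i : Fin 3) : IsTest (pd i f) :=
  ⟨contDiff_pd hf.smooth, hf.supp.fderiv_apply ℝ _⟩

lemma mul_left (hf : IsTest f) (hg : ContDiff ℝ ∞ g) : IsTest (fun x => g x * f x) :=
  ⟨hg.mul hf.smooth, hf.supp.mul_left⟩

lemma mul_right (hf : IsTest f) (hg : ContDiff ℝ ∞ g) : IsTest (fun x => f x * g x) :=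
  ⟨hf.smooth.mul hg, hf.supp.mul_right⟩

lemma add (hf : IsTest f) (hg : IsTest g) : IsTest (fun x => f x + g x) :=
  ⟨hf.smooth.add hg.smooth, hf.supp.add hg.supp⟩

lemma neg (hf : IsTest f) : IsTest (fun x => - f x) :=
  ⟨hf.smooth.neg, hf.supp.neg⟩

lemma zero : IsTest (fun _ : E3 => (0 : ℝ)) :=
  ⟨contDiff_const, HasCompactSupport.zero⟩

lemma sum {ι : Type*} {s : Finset ι} {f : ι → E3 → ℝ} (hf : ∀ i ∈ s, IsTest (f i)) :
    IsTest (fun x => ∑ i ∈ s, f i x) := by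
  classical
  induction s using Finset.induction_on with
  | empty => simpa using zero
  | insert a s ha ih =>
    simp only [Finset.sum_insert ha]
    exact (hf a (by simp)).add (ih fun i hi => hf i (by simp [hi]))

lemma slap (hf : IsTest f) : IsTest (slap f) :=
  sum fun m _ => (hf.pd m).pd m

lemma continuous (hh : IsTest h) : Continuous h := hh.smooth.continuous

lemma integrable (hh : IsTest h) : Integrable h :=
  hh.continuous.integrable_of_hasCompactSupport hh.supp

lemma exists_bound (hh : IsTest h) : ∃ C, 0 ≤ C ∧ ∀ x, ‖h x‖ ≤ C := by
  obtain ⟨C, hC⟩ := hh.supp.exists_bound_of_continuous hh.continuous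
  exact ⟨C, (norm_nonneg _).trans (hC 0), hC⟩

end IsTest

lemma pd_add {i : Fin 3} {f g : E3 → ℝ} (hf : ContDiff ℝ ∞ f) (hg : ContDiff ℝ ∞ g) (x : E3) :
    pd i (fun y => f y + g y) x = pd i f x + pd i g x := by
  unfold pd
  rw [fderiv_fun_add (hf.diff_top x) (hg.diff_top x)]
  rfl

lemma pd_mul {i : Fin 3} {f g : E3 → ℝ} (hf : ContDiff ℝ ∞ f) (hg : ContDiff ℝ ∞ g) (x : E3) :
    pd i (fun y => f y * g y) x = pd i f x * g x + f x * pd i g x := by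
  unfold pd
  rw [fderiv_fun_mul (hf.diff_top x) (hg.diff_top x)]
  simp
  ring

lemma pd_sum {ι : Type*} {s : Finset ι} {i : Fin 3} {f : ι → E3 → ℝ}
    (hf : ∀ j ∈ s, ContDiff ℝ ∞ (f j)) (x : E3) :
    pd i (fun y => ∑ j ∈ s, f j y) x = ∑ j ∈ s, pd i (f j) x := by
  unfold pd
  rw [fderiv_fun_sum fun j hj => (hf j hj).diff_top x]
  simp

lemma pd_comm {i j : Fin 3} {f : E3 → ℝ} (hf : ContDiff ℝ ∞ f) :
    pd i (pd j f) = pd j (pd i f) := by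
  have key : ∀ a b : Fin 3, ∀ x, pd a (pd b f) x =
      fderiv ℝ (fderiv ℝ f) x (EuclideanSpace.single a 1) (EuclideanSpace.single b 1) := by
    intro a b x
    have hd : DifferentiableAt ℝ (fderiv ℝ f) x :=
      (hf.fderiv_right (m := ∞) (by simp)).diff_top x
    change fderiv ℝ (fun y => fderiv ℝ f y (EuclideanSpace.single b 1)) x _ = _
    rw [fderiv_clm_apply hd (by fun_prop)]
    simp
  funext x
  rw [key, key]
  have : IsSymmSndFDerivAt ℝ f x :=
    (contDiff_infty.1 hf 2).contDiffAt.isSymmSndFDerivAt (by simp)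
  exact this _ _

lemma integral_mul_pd {i : Fin 3} {f g : E3 → ℝ} (hf : ContDiff ℝ ∞ f) (hg : IsTest g) :
    ∫ x, f x * pd i g x = - ∫ x, pd i f x * g x :=
  integral_mul_fderiv_eq_neg_fderiv_mul_of_integrable
    (hg.mul_left (contDiff_pd hf)).integrable ((hg.pd i).mul_left hf).integrable
    (hg.mul_left hf).integrable (fun x _ => hf.diff_top x) (fun x _ => hg.smooth.diff_top x)

lemma integral_pd_mul {i : Fin 3} {f g : E3 → ℝ} (hf : ContDiff ℝ ∞ f) (hg : IsTest g) :
    ∫ x, pd i f x * g x = - ∫ x, f x * pd i g x := by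
  rw [integral_mul_pd hf hg, neg_neg]

lemma integral_mul_slap {f g : E3 → ℝ} (hf : ContDiff ℝ ∞ f) (hg : IsTest g) :
    ∫ x, f x * slap g x = ∫ x, slap f x * g x := by
  have h1 : ∀ m, ∫ x, f x * pd m (pd m g) x = ∫ x, pd m (pd m f) x * g x := fun m => by
    rw [integral_mul_pd hf (hg.pd m), integral_mul_pd (contDiff_pd hf) hg, neg_neg]
  simp only [slap, Finset.mul_sum, Finset.sum_mul]
  rw [integral_finsetSum _ fun m _ => (((hg.pd m).pd m).mul_left hf).integrable,
    integral_finsetSum _ fun m _ => (hg.mul_left (contDiff_pd (contDiff_pd hf))).integrable]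
  exact Finset.sum_congr rfl fun m _ => h1 m

lemma slap_pd {i : Fin 3} {f : E3 → ℝ} (hf : ContDiff ℝ ∞ f) :
    slap (pd i f) = pd i (slap f) := by
  funext x
  unfold slap
  rw [pd_sum fun m _ => contDiff_pd (contDiff_pd hf)]
  refine Finset.sum_congr rfl fun m _ => ?_
  rw [pd_comm (i := m) hf, pd_comm (i := m) (contDiff_pd hf)]

/-- Weighted superposition of translates of a function. -/
def wavg {Ω F : Type*} [MeasurableSpace Ω] [NormedAddCommGroup F] [NormedSpace ℝ F]
    (ν : Measure Ω) (c : Ω → ℝ) (z : Ω → E3) (h : E3 → F) (x : E3) : F :=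
  ∫ τ, c τ • h (x + z τ) ∂ν

section wavg

variable {Ω F : Type*} [MeasurableSpace Ω] [NormedAddCommGroup F] [NormedSpace ℝ F]
  {ν : Measure Ω} {c : Ω → ℝ} {z : Ω → E3} {h : E3 → F}

lemma wavg_integrable (hc : Integrable c ν) (hz : Measurable z) (hh : Continuous h) {M : ℝ}
    (hM : ∀ x, ‖h x‖ ≤ M) (x : E3) : Integrable (fun τ => c τ • h (x + z τ)) ν := by
  have hm : AEStronglyMeasurable (fun τ => h (x + z τ)) ν :=
    (hh.comp (continuous_const.add continuous_id)).stronglyMeasurable.comp_measurable hz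
      |>.aestronglyMeasurable
  exact hc.smul_bdd M hm (Eventually.of_forall fun τ => hM _)

lemma norm_wavg_le (hc : Integrable c ν) {M : ℝ} (hM : ∀ x, ‖h x‖ ≤ M) (x : E3) :
    ‖wavg ν c z h x‖ ≤ (∫ τ, |c τ| ∂ν) * M := by
  unfold wavg
  rw [← integral_mul_const]
  refine norm_integral_le_of_norm_le (hc.abs.mul_const M) (Eventually.of_forall fun τ => ?_)
  rw [norm_smul, Real.norm_eq_abs]
  exact mul_le_mul_of_nonneg_left (hM _) (abs_nonneg _)

lemma hasFDerivAt_wavg (hc : Integrable c ν) (hz : Measurable z) (hh : IsTest h) (x : E3) :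
    HasFDerivAt (wavg ν c z h) (wavg ν c z (fderiv ℝ h) x) x := by
  obtain ⟨M, hM0, hM⟩ := hh.exists_bound
  obtain ⟨M', hM'0, hM'⟩ := hh.fderiv.exists_bound
  refine hasFDerivAt_integral_of_dominated_of_fderiv_le (s := Set.univ)
    (F := fun x τ => c τ • h (x + z τ)) (F' := fun x τ => c τ • fderiv ℝ h (x + z τ))
    (bound := fun τ => |c τ| * M') univ_mem
    (Eventually.of_forall fun y =>
      (wavg_integrable hc hz hh.continuous hM y).aestronglyMeasurable)
    (wavg_integrable hc hz hh.continuous hM x)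
    (wavg_integrable hc hz hh.fderiv.continuous hM' x).aestronglyMeasurable
    (Eventually.of_forall fun τ y _ => ?_) (hc.abs.mul_const _)
    (Eventually.of_forall fun τ y _ => ?_)
  · rw [norm_smul, Real.norm_eq_abs]
    exact mul_le_mul_of_nonneg_left (hM' _) (abs_nonneg _)
  · have h1 : HasFDerivAt h (fderiv ℝ h (y + z τ)) (y + z τ) :=
      (hh.smooth.diff_top _).hasFDerivAt
    have h2 : HasFDerivAt (fun y => y + z τ) (ContinuousLinearMap.id ℝ E3) y :=
      (hasFDerivAt_id y).add_const _
    have := (h1.comp y h2).const_smul (c τ)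
    simpa [Function.comp_def, Pi.smul_def] using this

lemma fderiv_wavg (hc : Integrable c ν) (hz : Measurable z) (hh : IsTest h) :
    fderiv ℝ (wavg ν c z h) = wavg ν c z (fderiv ℝ h) :=
  funext fun x => (hasFDerivAt_wavg hc hz hh x).fderiv

lemma contDiff_wavg_nat (n : ℕ) : ∀ {F : Type} [NormedAddCommGroup F] [NormedSpace ℝ F]
    {h : E3 → F}, Integrable c ν → Measurable z → IsTest h → ContDiff ℝ n (wavg ν c z h) := by
  induction n with
  | zero =>
    intro F _ _ h hc hz hh
    exact contDiff_zero.2 (continuous_iff_continuousAt.2 fun x =>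
      (hasFDerivAt_wavg hc hz hh x).continuousAt)
  | succ n ih =>
    intro F _ _ h hc hz hh
    push_cast
    rw [contDiff_succ_iff_fderiv]
    refine ⟨fun x => (hasFDerivAt_wavg hc hz hh x).differentiableAt, by simp, ?_⟩
    rw [fderiv_wavg hc hz hh]
    exact ih hc hz hh.fderiv

lemma contDiff_wavg {F : Type} [NormedAddCommGroup F] [NormedSpace ℝ F]
    {h : E3 → F} (hc : Integrable c ν) (hz : Measurable z) (hh : IsTest h) :
    ContDiff ℝ ∞ (wavg ν c z h) :=
  contDiff_infty.2 fun n => contDiff_wavg_nat n hc hz hh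

lemma pd_wavg {f : E3 → ℝ} (hc : Integrable c ν) (hz : Measurable z) (hf : IsTest f)
    (i : Fin 3) : pd i (wavg ν c z f) = wavg ν c z (pd i f) := by
  funext x
  obtain ⟨M', hM'0, hM'⟩ := hf.fderiv.exists_bound
  unfold pd
  rw [fderiv_wavg hc hz hf]
  unfold wavg
  rw [ContinuousLinearMap.integral_apply
    (wavg_integrable hc hz hf.fderiv.continuous hM' x)]
  rfl

lemma slap_wavg {f : E3 → ℝ} (hc : Integrable c ν) (hz : Measurable z) (hf : IsTest f) :
    slap (wavg ν c z f) = wavg ν c z (slap f) := by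
  funext x
  have h1 : ∀ m, pd m (pd m (wavg ν c z f)) = wavg ν c z (pd m (pd m f)) := fun m => by
    rw [pd_wavg hc hz hf, pd_wavg hc hz (hf.pd m)]
  unfold slap
  simp only [h1]
  unfold wavg
  simp only [Finset.smul_sum]
  rw [integral_finsetSum]
  intro m _
  obtain ⟨M, -, hM⟩ := ((hf.pd m).pd m).exists_bound
  exact wavg_integrable hc hz ((hf.pd m).pd m).continuous hM x

lemma integrable_prod_wavg [SFinite ν] {f : E3 → ℝ} (hc : Integrable c ν) (hz : Measurable z)
    (hf : Continuous f) (hfi : Integrable f) :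
    Integrable (fun q : E3 × Ω => c q.2 • f (q.1 + z q.2)) (volume.prod ν) := by
  have hm : AEStronglyMeasurable (fun q : E3 × Ω => c q.2 • f (q.1 + z q.2))
      (volume.prod ν) := by
    refine AEStronglyMeasurable.smul hc.aestronglyMeasurable.comp_snd ?_
    exact (hf.measurable.comp (measurable_fst.add (hz.comp measurable_snd))).aestronglyMeasurable
  rw [integrable_prod_iff' hm]
  constructor
  · exact Eventually.of_forall fun τ => (hfi.comp_add_right (z τ)).smul (c τ)
  · have : ∀ τ, ∫ x, ‖c τ • f (x + z τ)‖ = |c τ| * ∫ x, ‖f x‖ := fun τ => by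
      simp only [norm_smul, Real.norm_eq_abs]
      rw [integral_const_mul, integral_add_right_eq_self (fun x => |f x|)]
    simp only [this]
    exact hc.abs.mul_const _

lemma integrable_wavg [SFinite ν] {f : E3 → ℝ} (hc : Integrable c ν) (hz : Measurable z)
    (hf : Continuous f) (hfi : Integrable f) : Integrable (wavg ν c z f) :=
  (integrable_prod_wavg hc hz hf hfi).integral_prod_left

lemma integral_abs_wavg_le [SFinite ν] {f : E3 → ℝ} (hc : Integrable c ν) (hz : Measurable z)
    (hf : Continuous f) (hfi : Integrable f) :
    ∫ x, |wavg ν c z f x| ≤ (∫ τ, |c τ| ∂ν) * ∫ x, |f x| := by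
  have hp := integrable_prod_wavg hc hz hf hfi
  have h1 : ∫ x, |wavg ν c z f x| ≤ ∫ x, ∫ τ, ‖c τ • f (x + z τ)‖ ∂ν := by
    refine integral_mono (integrable_wavg hc hz hf hfi).abs hp.norm.integral_prod_left fun x => ?_
    exact norm_integral_le_integral_norm (fun τ => c τ • f (x + z τ))
  refine h1.trans (le_of_eq ?_)
  rw [integral_integral_swap hp.norm, ← integral_mul_const]
  congr 1
  funext τ
  simp only [norm_smul, Real.norm_eq_abs]
  rw [integral_const_mul, integral_add_right_eq_self (fun x => |f x|)]

end wavg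

/-- A pair of kernels with `y k(y) = -∇κ(y)`. -/
structure KernelPair (k κ : E3 → ℝ) : Prop where
  cont : Continuous k
  int : Integrable k
  int_mul : Integrable fun y => ‖y‖ * k y
  smooth : ContDiff ℝ ∞ κ
  int' : Integrable κ
  pd_eq : ∀ m y, pd m κ y = - (y m * k y)

/-- Dilated average `x ↦ ∫ k(y) h(x + s y) dy`. -/
def av (k : E3 → ℝ) (s : ℝ) (h : E3 → ℝ) : E3 → ℝ := wavg volume k (fun y => s • y) h

lemma fderiv_apply_eq_sum (f : E3 → ℝ) (x y : E3) : fderiv ℝ f x y = ∑ m, y m * pd m f x := by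
  have hy : y = ∑ m, y m • EuclideanSpace.single m (1 : ℝ) := by
    ext i
    simp [Finset.sum_apply, Pi.single_apply]
  conv_lhs => rw [hy]
  simp [pd]

lemma hasDerivAt_av {k κ : E3 → ℝ} (hk : KernelPair k κ) {h : E3 → ℝ} (hh : IsTest h) (x : E3)
    (s : ℝ) : HasDerivAt (fun s => av k s h x) (s * av κ s (slap h) x) s := by
  obtain ⟨M, hM0, hM⟩ := hh.exists_bound
  obtain ⟨M', hM'0, hM'⟩ := hh.fderiv.exists_bound
  have hz : ∀ s : ℝ, Measurable fun y : E3 => s • y := fun s => measurable_const_smul s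
  have hcoord : ∀ m, Integrable fun y : E3 => y m * k y := fun m => by
    refine hk.int_mul.mono ?_ (Eventually.of_forall fun y => ?_)
    · have := hk.cont
      fun_prop
    · rw [norm_mul, norm_mul, norm_norm]
      exact mul_le_mul_of_nonneg_right (PiLp.norm_apply_le y m) (norm_nonneg _)
  have hD : HasDerivAt (fun s => av k s h x)
      (∫ y, k y * fderiv ℝ h (x + s • y) y) s := by
    refine (hasDerivAt_integral_of_dominated_loc_of_deriv_le (s := Set.univ)
      (F := fun s y => k y * h (x + s • y))
      (F' := fun s y => k y * fderiv ℝ h (x + s • y) y)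
      (bound := fun y => M' * |‖y‖ * k y|) univ_mem
      (Eventually.of_forall fun t =>
        (wavg_integrable hk.int (hz t) hh.continuous hM x).aestronglyMeasurable)
      (wavg_integrable hk.int (hz s) hh.continuous hM x) ?_
      (Eventually.of_forall fun y t _ => ?_) (hk.int_mul.abs.const_mul _)
      (Eventually.of_forall fun y t _ => ?_)).2
    · have h1 := hk.cont
      have h2 := hh.fderiv.continuous
      have h3 : Continuous fun y : E3 => fderiv ℝ h (x + s • y) y :=
        (h2.comp (by fun_prop)).clm_apply continuous_id
      exact (h1.mul h3).aestronglyMeasurable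
    · rw [norm_mul, abs_mul, abs_norm, Real.norm_eq_abs]
      have := (fderiv ℝ h (x + t • y)).le_of_opNorm_le (hM' _) y
      nlinarith [abs_nonneg (k y)]
    · have h1 : HasFDerivAt h (fderiv ℝ h (x + t • y)) (x + t • y) :=
        (hh.smooth.diff_top _).hasFDerivAt
      have h2 : HasDerivAt (fun t : ℝ => x + t • y) y t := by
        simpa using ((hasDerivAt_id t).smul_const y).const_add x
      exact (h1.comp_hasDerivAt t h2).const_mul (k y)
  convert hD using 1
  have hpdb : ∀ m, ∃ C, 0 ≤ C ∧ ∀ x, ‖pd m h x‖ ≤ C := fun m => (hh.pd m).exists_bound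
  have hppb : ∀ m, ∃ C, 0 ≤ C ∧ ∀ x, ‖pd m (pd m h) x‖ ≤ C := fun m =>
    ((hh.pd m).pd m).exists_bound
  have hint1 : ∀ m, Integrable fun y : E3 => pd m κ y * pd m h (x + s • y) := fun m => by
    obtain ⟨C, -, hC⟩ := hpdb m
    simp only [hk.pd_eq]
    exact wavg_integrable (hcoord m).neg (hz s) (hh.pd m).continuous hC x
  have hint2 : ∀ m, Integrable fun y : E3 => κ y * pd m (pd m h) (x + s • y) := fun m => by
    obtain ⟨C, -, hC⟩ := hppb m
    exact wavg_integrable hk.int' (hz s) ((hh.pd m).pd m).continuous hC x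
  have hpdcomp : ∀ m (y : E3), fderiv ℝ (fun y => pd m h (x + s • y)) y
      (EuclideanSpace.single m 1) = s * pd m (pd m h) (x + s • y) := by
    intro m y
    have h1 : HasFDerivAt (pd m h) (fderiv ℝ (pd m h) (x + s • y)) (x + s • y) :=
      ((hh.pd m).smooth.diff_top _).hasFDerivAt
    have h2 : HasFDerivAt (fun y : E3 => x + s • y) (s • ContinuousLinearMap.id ℝ E3) y :=
      ((hasFDerivAt_id y).const_smul s).const_add x
    have h3 := (h1.comp y h2).fderiv
    have h4 : (fun y => pd m h (x + s • y)) = pd m h ∘ fun y => x + s • y := rfl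
    rw [h4, h3]
    simp [pd]
  have ibp : ∀ m, ∫ y, κ y * (s * pd m (pd m h) (x + s • y)) =
      - ∫ y, pd m κ y * pd m h (x + s • y) := by
    intro m
    have h5 := integral_mul_fderiv_eq_neg_fderiv_mul_of_integrable (μ := volume) (f := κ)
      (g := fun y => pd m h (x + s • y)) (v := EuclideanSpace.single m 1)
      (hint1 m) ?_ ?_ (fun y _ => hk.smooth.diff_top y) (fun y _ => ?_)
    · simp only [hpdcomp] at h5
      exact h5
    · simp only [hpdcomp]
      refine ((hint2 m).const_mul s).congr (Eventually.of_forall fun y => ?_)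
      ring
    · obtain ⟨C, -, hC⟩ := hpdb m
      exact wavg_integrable hk.int' (hz s) (hh.pd m).continuous hC x
    · exact ((hh.pd m).smooth.comp (by fun_prop : ContDiff ℝ ∞ fun y : E3 => x + s • y)).diff_top y
  calc s * av κ s (slap h) x = ∑ m, ∫ y, κ y * (s * pd m (pd m h) (x + s • y)) := by
        unfold av wavg slap
        simp only [smul_eq_mul, Finset.mul_sum]
        rw [integral_finsetSum _ fun m _ => hint2 m, Finset.mul_sum]
        refine Finset.sum_congr rfl fun m _ => ?_
        rw [← integral_const_mul]
        congr 1; funext y; ring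
    _ = ∑ m, ∫ y, y m * k y * pd m h (x + s • y) := by
        refine Finset.sum_congr rfl fun m _ => ?_
        rw [ibp, ← integral_neg]
        congr 1; funext y; rw [hk.pd_eq]; ring
    _ = ∫ y, k y * fderiv ℝ h (x + s • y) y := by
        rw [← integral_finsetSum]
        · congr 1; funext y
          rw [fderiv_apply_eq_sum, Finset.mul_sum]
          exact Finset.sum_congr rfl fun m _ => by ring
        · intro m _
          obtain ⟨C, -, hC⟩ := hpdb m
          exact wavg_integrable (hcoord m) (hz s) (hh.pd m).continuous hC x

lemma pd_radial {ψ : ℝ → ℝ} (hψ : ContDiff ℝ ∞ ψ) (m : Fin 3) (y : E3) :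
    pd m (fun y => ψ (‖y‖ ^ 2)) y = - (y m * (-2 * deriv ψ (‖y‖ ^ 2))) := by
  have h1 : HasDerivAt ψ (deriv ψ (‖y‖ ^ 2)) (‖y‖ ^ 2) :=
    (hψ.differentiable (by simp) _).hasDerivAt
  have h2 := (hasStrictFDerivAt_norm_sq y).hasFDerivAt
  have h3 := (h1.comp_hasFDerivAt y h2).fderiv
  have h4 : (fun y : E3 => ψ (‖y‖ ^ 2)) = ψ ∘ fun y : E3 => ‖y‖ ^ 2 := rfl
  unfold pd
  rw [h4, h3]
  simp [EuclideanSpace.inner_single_right]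
  ring

lemma gaussian_integrable {b : ℝ} (hb : 0 < b) :
    Integrable fun y : E3 => Real.exp (-b * ‖y‖ ^ 2) := by
  have h := (GaussianFourier.integrable_cexp_neg_mul_sq_norm_add (V := E3) (b := (b : ℂ))
    (by simpa using hb) 0 0).norm
  refine h.congr (Eventually.of_forall fun y => ?_)
  simp [Complex.norm_exp]
  left
  norm_cast

lemma exists_gaussian : ∃ γ : E3 → ℝ, KernelPair γ γ ∧ (∀ y, 0 ≤ γ y) ∧ ∫ y, γ y = 1 ∧
    ∃ M, ∀ y, γ y ≤ M := by
  let ψ : ℝ → ℝ := fun r => Real.exp (-(1 / 2) * r)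
  have hψ : ContDiff ℝ ∞ ψ := by fun_prop
  have hdψ : ∀ r, deriv ψ r = -(1 / 2) * ψ r := fun r => by
    have := ((hasDerivAt_id r).const_mul (-(1 / 2) : ℝ)).exp
    rw [show ψ = fun r => Real.exp (-(1 / 2) * id r) from rfl, this.deriv]
    simp
    ring
  let g : E3 → ℝ := fun y => ψ (‖y‖ ^ 2)
  have hgi : Integrable g := gaussian_integrable (by norm_num)
  have hgpos : ∀ y, 0 < g y := fun y => Real.exp_pos _
  have hgsm : ContDiff ℝ ∞ g := hψ.comp (contDiff_norm_sq ℝ)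
  have hgi2 : Integrable fun y : E3 => ‖y‖ * g y := by
    refine (gaussian_integrable (b := 1 / 4) (by norm_num)).mono
      (by have := hgsm.continuous; fun_prop) (Eventually.of_forall fun y => ?_)
    rw [norm_mul, norm_norm, Real.norm_of_nonneg (hgpos y).le,
      Real.norm_of_nonneg (Real.exp_pos _).le]
    have h1 : ‖y‖ ≤ Real.exp (1 / 4 * ‖y‖ ^ 2) := by
      have := Real.add_one_le_exp (1 / 4 * ‖y‖ ^ 2)
      nlinarith [sq_nonneg (‖y‖ / 2 - 1)]
    calc ‖y‖ * g y ≤ Real.exp (1 / 4 * ‖y‖ ^ 2) * Real.exp (-(1 / 2) * ‖y‖ ^ 2) :=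
          mul_le_mul_of_nonneg_right h1 (hgpos y).le
      _ = _ := by rw [← Real.exp_add]; congr 1; ring
  have hI : 0 < ∫ y, g y := by
    rw [integral_pos_iff_support_of_nonneg (fun y => (hgpos y).le) hgi]
    have : Function.support g = Set.univ := Set.eq_univ_of_forall fun y => (hgpos y).ne'
    rw [this]
    simp
  have hpd : ∀ m y, pd m g y = -(y m * g y) := fun m y => by
    rw [pd_radial hψ, hdψ]
    ring
  set I := ∫ y, g y with hIdef
  refine ⟨fun y => I⁻¹ * g y, ⟨continuous_const.mul hgsm.continuous, hgi.const_mul _, ?_,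
    contDiff_const.mul hgsm, hgi.const_mul _, fun m y => ?_⟩,
    fun y => mul_nonneg (inv_nonneg.2 hI.le) (hgpos y).le, ?_, I⁻¹ * 1, fun y => ?_⟩
  · refine (hgi2.const_mul I⁻¹).congr (Eventually.of_forall fun y => ?_)
    ring
  · have := pd_mul (i := m) (f := fun _ => I⁻¹) contDiff_const hgsm y
    rw [this, hpd]
    simp [pd]
    ring
  · rw [integral_const_mul, inv_mul_cancel₀ hI.ne']
  · refine mul_le_mul_of_nonneg_left ?_ (inv_nonneg.2 hI.le)
    refine Real.exp_le_one_iff.2 ?_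
    nlinarith [sq_nonneg ‖y‖]

lemma exists_compact_kernel {δ : ℝ} (hδ : 0 < δ) : ∃ k κ : E3 → ℝ, KernelPair k κ ∧ IsTest k ∧
    IsTest κ ∧ (∀ y, δ ≤ ‖y‖ → k y = 0) ∧ (∀ y, δ ≤ ‖y‖ → κ y = 0) ∧ ∫ y, k y = 1 ∧
    (∀ y, k (-y) = k y) := by
  let ψ : ℝ → ℝ := fun r => Real.smoothTransition (1 - r / δ ^ 2)
  have hψ : ContDiff ℝ ∞ ψ := Real.smoothTransition.contDiff.comp (by fun_prop)
  have hanti : Antitone ψ := fun a b hab => Real.smoothTransition.monotone (by gcongr)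
  have hψ0 : ∀ r, δ ^ 2 ≤ r → ψ r = 0 := fun r hr =>
    Real.smoothTransition.zero_of_nonpos (by
      have : 1 ≤ r / δ ^ 2 := (one_le_div (by positivity)).2 hr
      linarith)
  have hdψ0 : ∀ r, δ ^ 2 ≤ r → deriv ψ r = 0 := fun r hr => by
    refine le_antisymm hanti.deriv_nonpos ?_
    have hd := (hψ.differentiable (by simp) r).hasDerivAt
    have h1 : HasDerivWithinAt ψ (deriv ψ r) (Set.Ici r) r := hd.hasDerivWithinAt
    have h2 : HasDerivWithinAt ψ 0 (Set.Ici r) r :=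
      (hasDerivWithinAt_const r (Set.Ici r) (0 : ℝ)).congr (fun x hx => hψ0 x (hr.trans hx))
        (hψ0 r hr)
    rw [(uniqueDiffWithinAt_Ici r).eq_deriv _ h1 h2]
  let κ0 : E3 → ℝ := fun y => ψ (‖y‖ ^ 2)
  let k0 : E3 → ℝ := fun y => -2 * deriv ψ (‖y‖ ^ 2)
  have hκsm : ContDiff ℝ ∞ κ0 := hψ.comp (contDiff_norm_sq ℝ)
  have hdsm : ContDiff ℝ ∞ (deriv ψ) := (contDiff_infty_iff_deriv.1 hψ).2
  have hksm : ContDiff ℝ ∞ k0 := contDiff_const.mul (hdsm.comp (contDiff_norm_sq ℝ))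
  have hsq : ∀ y : E3, δ ≤ ‖y‖ → δ ^ 2 ≤ ‖y‖ ^ 2 := fun y hy => by gcongr
  have hκ0 : ∀ y, δ ≤ ‖y‖ → κ0 y = 0 := fun y hy => hψ0 _ (hsq y hy)
  have hk0 : ∀ y, δ ≤ ‖y‖ → k0 y = 0 := fun y hy => by simp [k0, hdψ0 _ (hsq y hy)]
  have hcs : ∀ f : E3 → ℝ, (∀ y, δ ≤ ‖y‖ → f y = 0) → HasCompactSupport f := fun f hf =>
    HasCompactSupport.intro (isCompact_closedBall (0 : E3) δ) fun y hy => hf y (by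
      simp at hy
      exact hy.le)
  have hκT : IsTest κ0 := ⟨hκsm, hcs _ hκ0⟩
  have hkT : IsTest k0 := ⟨hksm, hcs _ hk0⟩
  have hknn : ∀ y, 0 ≤ k0 y := fun y => by
    have : deriv ψ (‖y‖ ^ 2) ≤ 0 := hanti.deriv_nonpos
    simp only [k0]
    linarith
  have hpd : ∀ m y, pd m κ0 y = -(y m * k0 y) := fun m y => pd_radial hψ m y
  have hI : 0 < ∫ y, k0 y := by
    have hne : k0 ≠ 0 := by
      intro h0
      have hfd : ∀ x, fderiv ℝ κ0 x = 0 := fun x => by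
        ext y
        rw [fderiv_apply_eq_sum]
        simp [hpd, h0]
      have hc := is_const_of_fderiv_eq_zero hκsm.diff_top hfd
      have h1 := hc 0 (EuclideanSpace.single 0 δ)
      rw [hκ0 (EuclideanSpace.single 0 δ) (by simp [abs_of_pos hδ])] at h1
      simp [κ0, ψ] at h1
    obtain ⟨x, hx⟩ := Function.ne_iff.1 hne
    exact hkT.continuous.integral_pos_of_hasCompactSupport_nonneg_nonzero hkT.supp hknn hx
  set I := ∫ y, k0 y with hIdef
  have hkT' : IsTest fun y => I⁻¹ * k0 y := hkT.mul_left contDiff_const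
  have hκT' : IsTest fun y => I⁻¹ * κ0 y := hκT.mul_left contDiff_const
  refine ⟨fun y => I⁻¹ * k0 y, fun y => I⁻¹ * κ0 y, ⟨hkT'.continuous, hkT'.integrable, ?_,
    hκT'.smooth, hκT'.integrable, fun m y => ?_⟩, hkT', hκT', fun y hy => ?_, fun y hy => ?_, ?_,
    fun y => ?_⟩
  · exact (continuous_norm.mul hkT'.continuous).integrable_of_hasCompactSupport
      hkT'.supp.mul_left
  · rw [pd_mul (i := m) (f := fun _ => I⁻¹) contDiff_const hκsm y, hpd]
    simp [pd]
    ring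
  · simp [hk0 y hy]
  · simp [hκ0 y hy]
  · rw [integral_const_mul, inv_mul_cancel₀ hI.ne']
  · simp [k0]

/-- Bounded continuous integrable functions. -/
structure BddInt (h : E3 → ℝ) : Prop where
  cont : Continuous h
  int : Integrable h
  bdd : ∃ C, ∀ x, |h x| ≤ C

namespace BddInt

variable {f g : E3 → ℝ}

lemma mul_left (hf : BddInt f) (hg : Continuous g) {C : ℝ} (hC : ∀ x, |g x| ≤ C) :
    BddInt fun x => g x * f x := by
  obtain ⟨C', hC'⟩ := hf.bdd
  refine ⟨hg.mul hf.cont, hf.int.bdd_mul (c := C) hg.aestronglyMeasurable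
    (Eventually.of_forall hC), C * C', fun x => ?_⟩
  rw [abs_mul]
  exact mul_le_mul (hC x) (hC' x) (abs_nonneg _) ((abs_nonneg _).trans (hC x))

lemma mul (hg : BddInt g) (hf : BddInt f) : BddInt fun x => g x * f x :=
  hf.mul_left hg.cont hg.bdd.choose_spec

lemma add (hf : BddInt f) (hg : BddInt g) : BddInt fun x => f x + g x := by
  obtain ⟨C, hC⟩ := hf.bdd
  obtain ⟨C', hC'⟩ := hg.bdd
  exact ⟨hf.cont.add hg.cont, hf.int.add hg.int, C + C', fun x =>
    (abs_add_le _ _).trans (add_le_add (hC x) (hC' x))⟩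

lemma const_mul (hf : BddInt f) (c : ℝ) : BddInt fun x => c * f x :=
  hf.mul_left continuous_const fun _ => le_rfl

lemma sum {ι : Type*} {s : Finset ι} {f : ι → E3 → ℝ} (hf : ∀ i ∈ s, BddInt (f i)) :
    BddInt fun x => ∑ i ∈ s, f i x := by
  classical
  induction s using Finset.induction_on with
  | empty => exact ⟨by simpa using continuous_const, by simp, 0, by simp⟩
  | insert a s ha ih =>
    simp only [Finset.sum_insert ha]
    exact (hf a (by simp)).add (ih fun i hi => hf i (by simp [hi]))

end BddInt

/-- Smooth functions whose derivatives of order at most two are bounded and integrable. -/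
structure Nice (h : E3 → ℝ) : Prop where
  smooth : ContDiff ℝ ∞ h
  zero : BddInt h
  one : ∀ m, BddInt (pd m h)
  two : ∀ m l, BddInt (pd m (pd l h))

lemma Nice.slap {h : E3 → ℝ} (hh : Nice h) : BddInt (slap h) :=
  BddInt.sum fun m _ => hh.two m m

lemma integral_pd_eq_zero {w : E3 → ℝ} (m : Fin 3) (hw : ContDiff ℝ ∞ w) (h0 : Integrable w)
    (h1 : Integrable (pd m w)) : ∫ x, pd m w x = 0 := by
  have h := integral_mul_fderiv_eq_neg_fderiv_mul_of_integrable (μ := volume)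
    (f := fun _ : E3 => (1 : ℝ)) (g := w) (v := EuclideanSpace.single m 1)
    (by simp) (by simp only [one_mul]; exact h1) (by simpa using h0) (fun x _ => by fun_prop)
    (fun x _ => hw.diff_top x)
  simpa [pd] using h

lemma bellman_hessian {r a a' X u v : ℝ} (hr : 0 < r) (hu : |u| ≤ r) (hv : v = X - 2 * u * a) :
    |v * a'| ≤ 3 / 4 * X ^ 2 / r + r * a ^ 2 + 2 * (r * a' ^ 2) := by
  subst hv
  have h1 : |X * a'| ≤ 3 / 4 * X ^ 2 / r + r * a' ^ 2 := by
    have : X * a' * r ≤ 3 / 4 * X ^ 2 + r ^ 2 * a' ^ 2 ∧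
        -(X * a' * r) ≤ 3 / 4 * X ^ 2 + r ^ 2 * a' ^ 2 := by
      constructor <;> nlinarith [sq_nonneg (X - r * a'), sq_nonneg (X + r * a'), sq_nonneg X,
        sq_nonneg (X / 2 - r * a'), sq_nonneg (X / 2 + r * a')]
    have e : 3 / 4 * X ^ 2 / r + r * a' ^ 2 = (3 / 4 * X ^ 2 + r ^ 2 * a' ^ 2) / r := by
      field_simp
    rw [e, abs_le, le_div_iff₀ hr, neg_le, le_div_iff₀ hr]
    constructor <;> linarith [this.1, this.2]
  have h2 : |2 * u * a * a'| ≤ r * a ^ 2 + r * a' ^ 2 := by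
    have e : |2 * u * a * a'| = |u| * (2 * (|a| * |a'|)) := by
      simp only [abs_mul, abs_two]; ring
    have h3 : 2 * (|a| * |a'|) ≤ a ^ 2 + a' ^ 2 := by
      nlinarith [sq_nonneg (|a| - |a'|), sq_abs a, sq_abs a']
    rw [e]
    calc |u| * (2 * (|a| * |a'|)) ≤ r * (a ^ 2 + a' ^ 2) := by gcongr
      _ = _ := by ring
  calc |(X - 2 * u * a) * a'| = |X * a' - 2 * u * a * a'| := by ring_nf
    _ ≤ |X * a'| + |2 * u * a * a'| := abs_sub _ _
    _ ≤ _ := by linarith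

lemma bellman_static {U V Z : E3 → ℝ} (hU : Nice U) (hV : Nice V) (hZ : Nice Z)
    (hV0 : ∀ x, 0 ≤ V x) {κ θ : ℝ} (hκ : 0 < κ) (hθ : |θ| ≤ 1 / 2) {i j : Fin 3}
    (hZU : slap Z = pd i (pd j U)) :
    ∫ x, (3 / 2 * √(U x ^ 2 + V x + κ) * (2 * U x * slap U x + slap V x) +
      θ * (slap V x * Z x + V x * slap Z x)) ≤ 0 := by
  obtain ⟨CU, hCU⟩ := hU.zero.bdd
  obtain ⟨CV, hCV⟩ := hV.zero.bdd
  have hCU0 : 0 ≤ CU := (abs_nonneg _).trans (hCU 0)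
  have sU := hU.smooth
  have sV := hV.smooth
  have sZ := hZ.smooth
  set n : E3 → ℝ := fun x => U x ^ 2 + V x + κ with hn
  have hnκ : ∀ x, κ ≤ n x := fun x => by
    have := hV0 x; simp only [hn]; nlinarith [sq_nonneg (U x)]
  have hn0 : ∀ x, 0 < n x := fun x => hκ.trans_le (hnκ x)
  have hnle : ∀ x, n x ≤ CU ^ 2 + CV + κ := fun x => by
    have h1 := abs_le.1 (hCU x)
    have h2 := (abs_le.1 (hCV x)).2
    have h3 : U x ^ 2 ≤ CU ^ 2 := sq_le_sq' h1.1 h1.2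
    simp only [hn]; linarith
  have sn : ContDiff ℝ ∞ n := by fun_prop
  set r : E3 → ℝ := fun x => √(n x) with hr
  have sr : ContDiff ℝ ∞ r := sn.sqrt fun x => (hn0 x).ne'
  have hr0 : ∀ x, 0 < r x := fun x => Real.sqrt_pos.2 (hn0 x)
  have hrr : ∀ x, r x * r x = n x := fun x => Real.mul_self_sqrt (hn0 x).le
  have hrb : ∀ x, |r x| ≤ √(CU ^ 2 + CV + κ) := fun x => by
    rw [abs_of_pos (hr0 x)]
    exact Real.sqrt_le_sqrt (hnle x)
  have hrκ : ∀ x, √κ ≤ r x := fun x => Real.sqrt_le_sqrt (hnκ x)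
  have hκ' : 0 < √κ := Real.sqrt_pos.2 hκ
  have hUr : ∀ x, |U x| ≤ r x := fun x => Real.abs_le_sqrt (by
    have := hV0 x; simp only [hn]; linarith)
  have hX : ∀ m x, pd m n x = 2 * U x * pd m U x + pd m V x := fun m x => by
    have e : n = fun x => (U x * U x + V x) + κ := by funext x; simp only [hn]; ring
    rw [e, pd_add (by fun_prop) contDiff_const, pd_add (by fun_prop) sV, pd_mul sU sU]
    simp [pd]; ring
  have hXB : ∀ m, BddInt (pd m n) := fun m => by
    have : pd m n = fun x => 2 * (U x * pd m U x) + pd m V x := by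
      funext x; rw [hX]; ring
    rw [this]
    exact ((hU.zero.mul (hU.one m)).const_mul 2).add (hV.one m)
  have hXX : ∀ m x, pd m (pd m n) x =
      2 * (pd m U x) ^ 2 + 2 * U x * pd m (pd m U) x + pd m (pd m V) x := fun m x => by
    have e : pd m n = fun x => (U x * pd m U x + U x * pd m U x) + pd m V x := by
      funext x; rw [hX]; ring
    have s1 : ContDiff ℝ ∞ fun x => U x * pd m U x := by fun_prop
    rw [e, pd_add (s1.add s1) (by fun_prop), pd_add s1 s1, pd_mul sU (by fun_prop)]
    ring
  have hXXB : ∀ m, BddInt (pd m (pd m n)) := fun m => by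
    have : pd m (pd m n) = fun x =>
        (2 * (pd m U x * pd m U x) + 2 * (U x * pd m (pd m U) x)) + pd m (pd m V) x := by
      funext x; rw [hXX]; ring
    rw [this]
    exact ((((hU.one m).mul (hU.one m)).const_mul 2).add
      ((hU.zero.mul (hU.two m m)).const_mul 2)).add (hV.two m m)
  have hpr : ∀ m x, pd m r x = pd m n x / (2 * r x) := fun m x => by
    unfold pd
    rw [hr, fderiv_sqrt (sn.diff_top x) (hn0 x).ne']
    simp; ring
  set β : Fin 3 → E3 → ℝ := fun m x => r x * pd m n x with hβ
  have sβ : ∀ m, ContDiff ℝ ∞ (β m) := fun m => by fun_prop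
  have hβB : ∀ m, BddInt (β m) := fun m => (hXB m).mul_left sr.continuous hrb
  have hpβ : ∀ m x, pd m (β m) x = (pd m n x) ^ 2 / (2 * r x) + r x * pd m (pd m n) x :=
    fun m x => by
      rw [hβ, pd_mul sr (by fun_prop), hpr]; ring
  have hpβB : ∀ m, BddInt (pd m (β m)) := fun m => by
    have : pd m (β m) = fun x => (2 * r x)⁻¹ * (pd m n x * pd m n x) + r x * pd m (pd m n) x := by
      funext x; rw [hpβ]; ring
    rw [this]
    refine (((hXB m).mul (hXB m)).mul_left (C := (2 * √κ)⁻¹) ?_ fun x => ?_).add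
      ((hXXB m).mul_left sr.continuous hrb)
    · exact Continuous.inv₀ (continuous_const.mul sr.continuous) fun x => by
        have := hr0 x; positivity
    · have h0 := hr0 x
      have h1 := hrκ x
      rw [abs_of_pos (by positivity)]
      gcongr
  set ζ : Fin 3 → E3 → ℝ := fun m x => pd m V x * Z x + (-1) * (V x * pd m Z x) with hζ
  have sζ : ∀ m, ContDiff ℝ ∞ (ζ m) := fun m => by fun_prop
  have hζB : ∀ m, BddInt (ζ m) := fun m =>
    ((hV.one m).mul hZ.zero).add ((hV.zero.mul (hZ.one m)).const_mul _)
  have hpζ : ∀ m x, pd m (ζ m) x = pd m (pd m V) x * Z x + (-1) * (V x * pd m (pd m Z) x) :=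
    fun m x => by
      rw [hζ, pd_add (by fun_prop) (by fun_prop), pd_mul (by fun_prop) sZ,
        pd_mul contDiff_const (by fun_prop), pd_mul sV (by fun_prop)]
      simp [pd]
      ring
  have hpζB : ∀ m, BddInt (pd m (ζ m)) := fun m => by
    rw [show pd m (ζ m) = _ from funext (hpζ m)]
    exact ((hV.two m m).mul hZ.zero).add ((hV.zero.mul (hZ.two m m)).const_mul _)
  set ξ : E3 → ℝ := fun x => V x * pd j U x with hξ
  have sξ : ContDiff ℝ ∞ ξ := by fun_prop
  have hpξ : ∀ x, pd i ξ x = pd i V x * pd j U x + V x * pd i (pd j U) x := fun x => by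
    rw [hξ, pd_mul sV (by fun_prop)]
  have hpξB : BddInt (pd i ξ) := by
    rw [show pd i ξ = _ from funext hpξ]
    exact ((hV.one i).mul (hU.one j)).add (hV.zero.mul (hU.two i j))
  have hTB : ∀ m, BddInt fun x => 3 / 2 * pd m (β m) x + θ * pd m (ζ m) x := fun m =>
    ((hpβB m).const_mul _).add ((hpζB m).const_mul _)
  have hGB : BddInt fun x => (∑ m, (3 / 2 * pd m (β m) x + θ * pd m (ζ m) x)) +
      2 * θ * pd i ξ x := (BddInt.sum fun m _ => hTB m).add (hpξB.const_mul _)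
  have hG : ∫ x, ((∑ m, (3 / 2 * pd m (β m) x + θ * pd m (ζ m) x)) + 2 * θ * pd i ξ x) = 0 := by
    rw [integral_add (BddInt.sum fun m _ => hTB m).int (hpξB.const_mul _).int,
      integral_finsetSum _ fun m _ => (hTB m).int, integral_const_mul,
      integral_pd_eq_zero i sξ (hV.zero.mul (hU.one j)).int hpξB.int]
    simp only [mul_zero, add_zero]
    refine Finset.sum_eq_zero fun m _ => ?_
    rw [integral_add ((hpβB m).const_mul _).int ((hpζB m).const_mul _).int, integral_const_mul,
      integral_const_mul, integral_pd_eq_zero m (sβ m) (hβB m).int (hpβB m).int,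
      integral_pd_eq_zero m (sζ m) (hζB m).int (hpζB m).int]
    simp
  rw [← hG]
  refine integral_mono (BddInt.int ?_) hGB.int fun x => ?_
  · refine BddInt.add ?_ (((hV.slap.mul hZ.zero).add (hV.zero.mul hZ.slap)).const_mul _)
    refine BddInt.mul_left (C := |3 / 2| * √(CU ^ 2 + CV + κ)) (BddInt.add ?_ hV.slap)
      (continuous_const.mul sr.continuous) fun x => ?_
    · simp only [mul_assoc]
      exact (hU.zero.mul hU.slap).const_mul 2
    · rw [abs_mul]
      exact mul_le_mul_of_nonneg_left (hrb x) (abs_nonneg _)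
  · have hZx : slap Z x = pd i (pd j U) x := by rw [hZU]
    have hkey : |pd i V x * pd j U x| ≤
        ∑ m, (3 / 4 * (pd m n x) ^ 2 / r x + 3 * (r x * (pd m U x) ^ 2)) := by
      have h1 := bellman_hessian (a := pd i U x) (a' := pd j U x) (X := pd i n x)
        (v := pd i V x) (hr0 x) (hUr x) (by rw [hX]; ring)
      have h2 : 0 < r x := hr0 x
      have hX0 : ∀ m, 0 ≤ 3 / 4 * (pd m n x) ^ 2 / r x := fun m => by positivity
      have ha0 : ∀ m, 0 ≤ r x * (pd m U x) ^ 2 := fun m => by positivity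
      have hs : 3 / 4 * (pd i n x) ^ 2 / r x + r x * (pd i U x) ^ 2 + 2 * (r x * (pd j U x) ^ 2)
          ≤ ∑ m, (3 / 4 * (pd m n x) ^ 2 / r x + 3 * (r x * (pd m U x) ^ 2)) := by
        rw [Finset.sum_add_distrib, ← Finset.mul_sum]
        have e1 := Finset.single_le_sum (f := fun m => 3 / 4 * (pd m n x) ^ 2 / r x)
          (fun m _ => hX0 m) (Finset.mem_univ i)
        have e2 := Finset.single_le_sum (f := fun m => r x * (pd m U x) ^ 2)
          (fun m _ => ha0 m) (Finset.mem_univ i)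
        have e3 := Finset.single_le_sum (f := fun m => r x * (pd m U x) ^ 2)
          (fun m _ => ha0 m) (Finset.mem_univ j)
        linarith
      exact h1.trans hs
    have hab : -(∑ m, (3 / 4 * (pd m n x) ^ 2 / r x + 3 * (r x * (pd m U x) ^ 2))) ≤
        2 * θ * (pd i V x * pd j U x) := by
      have h1 : |2 * θ * (pd i V x * pd j U x)| ≤ 1 * |pd i V x * pd j U x| := by
        rw [abs_mul]
        refine mul_le_mul_of_nonneg_right ?_ (abs_nonneg _)
        rw [abs_mul, abs_two]; linarith
      have := (abs_le.1 h1).1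
      linarith
    have hexp : (∑ m, (3 / 2 * pd m (β m) x + θ * pd m (ζ m) x)) + 2 * θ * pd i ξ x =
        3 / 2 * r x * (2 * U x * slap U x + slap V x) + θ * (slap V x * Z x + V x * slap Z x)
        + (∑ m, (3 / 4 * (pd m n x) ^ 2 / r x + 3 * (r x * (pd m U x) ^ 2))
        + 2 * θ * (pd i V x * pd j U x)) := by
      have hz2 : 2 * θ * pd i ξ x = 2 * θ * (pd i V x * pd j U x) + 2 * θ * (V x * slap Z x) := by
        rw [hpξ, hZx]; ring
      rw [hz2]
      simp only [hpβ, hpζ, hXX, slap, Fin.sum_univ_three]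
      have := hr0 x
      field_simp
      ring
    have hgoal : 3 / 2 * √(U x ^ 2 + V x + κ) = 3 / 2 * r x := rfl
    change 3 / 2 * √(U x ^ 2 + V x + κ) * (2 * U x * slap U x + slap V x) +
      θ * (slap V x * Z x + V x * slap Z x) ≤
      (∑ m, (3 / 2 * pd m (β m) x + θ * pd m (ζ m) x)) + 2 * θ * pd i ξ x
    rw [hexp, hgoal]
    linarith

lemma continuous_av {k h : E3 → ℝ} (hk : Integrable k) (hkc : Continuous k) (hh : IsTest h) :
    Continuous fun p : ℝ × E3 => av k p.1 h p.2 := by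
  obtain ⟨M, -, hM⟩ := hh.exists_bound
  have hc := hh.continuous
  refine continuous_of_dominated (F := fun (p : ℝ × E3) y => k y • h (p.2 + p.1 • y))
    (bound := fun y => |k y| * M) (fun p => ?_) (fun p => Eventually.of_forall fun y => ?_)
    (hk.abs.mul_const _) (Eventually.of_forall fun y => ?_)
  · exact Continuous.aestronglyMeasurable (by fun_prop)
  · rw [norm_smul, Real.norm_eq_abs]
    exact mul_le_mul_of_nonneg_left (hM _) (abs_nonneg _)
  · fun_prop

lemma measurable_smul_E3 (s : ℝ) : Measurable fun y : E3 => s • y := measurable_const_smul s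

lemma bddInt_av {k h : E3 → ℝ} (hk : Integrable k) (hkc : Continuous k) (hh : IsTest h) (s : ℝ) :
    BddInt (av k s h) := by
  obtain ⟨M, -, hM⟩ := hh.exists_bound
  exact ⟨(continuous_av hk hkc hh).comp (by fun_prop : Continuous fun x : E3 => (s, x)),
    integrable_wavg hk (measurable_smul_E3 s) hh.continuous hh.integrable, _,
    fun x => norm_wavg_le hk hM x⟩

lemma pd_av {k h : E3 → ℝ} (hk : Integrable k) (hh : IsTest h) (s : ℝ) (m : Fin 3) :
    pd m (av k s h) = av k s (pd m h) := pd_wavg hk (measurable_smul_E3 s) hh m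

lemma slap_av {k h : E3 → ℝ} (hk : Integrable k) (hh : IsTest h) (s : ℝ) :
    slap (av k s h) = av k s (slap h) := slap_wavg hk (measurable_smul_E3 s) hh

lemma nice_av {k h : E3 → ℝ} (hk : Integrable k) (hkc : Continuous k) (hh : IsTest h) (s : ℝ) :
    Nice (av k s h) where
  smooth := contDiff_wavg hk (measurable_smul_E3 s) hh
  zero := bddInt_av hk hkc hh s
  one m := by
    rw [pd_av hk hh]
    exact bddInt_av hk hkc (hh.pd m) s
  two m l := by
    rw [pd_av hk hh, pd_av hk (hh.pd l)]
    exact bddInt_av hk hkc ((hh.pd l).pd m) s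

lemma av_zero {k h : E3 → ℝ} (hk : ∫ y, k y = 1) (x : E3) : av k 0 h x = h x := by
  simp [av, wavg, integral_mul_const, hk]

lemma abs_av_le_inv_cube {k h : E3 → ℝ} {M : ℝ} (hk0 : ∀ y, 0 ≤ k y) (hkM : ∀ y, k y ≤ M)
    (hh : IsTest h) {s : ℝ} (hs : 0 < s) (x : E3) :
    |av k s h x| ≤ M * ((s ^ 3)⁻¹ * ∫ y, |h y|) := by
  have hc := hh.continuous
  have e : ∫ y : E3, |h (x + s • y)| = (s ^ 3)⁻¹ * ∫ y, |h y| := by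
    have h1 := Measure.integral_comp_smul (μ := (volume : Measure E3))
      (fun y => |h (x + y)|) s
    rw [h1, integral_add_left_eq_self (fun y => |h y|) x]
    simp [abs_of_pos hs]
  have hi : Integrable fun y : E3 => |h (x + s • y)| := by
    have h1 : Integrable fun y : E3 => h (x + y) := hh.integrable.comp_add_left x
    exact (h1.comp_smul hs.ne').abs
  rw [← e, ← integral_const_mul]
  change ‖∫ y, k y • h (x + s • y)‖ ≤ _
  refine norm_integral_le_of_norm_le (hi.const_mul M) (Eventually.of_forall fun y => ?_)
  rw [norm_smul, Real.norm_of_nonneg (hk0 y), Real.norm_eq_abs]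
  exact mul_le_mul_of_nonneg_right (hkM y) (abs_nonneg _)

lemma integral_add_aux {f g h : E3 → ℝ} (hf : Integrable f) (hg : Integrable g)
    (hh : Integrable h) (a b c d e : ℝ) :
    ∫ x, (a * (b * f x + g x) + c * (d * g x + e * h x)) =
      a * (b * (∫ x, f x) + ∫ x, g x) + c * (d * (∫ x, g x) + e * ∫ x, h x) := by
  have h1 : Integrable fun x => b * f x + g x := (hf.const_mul b).add hg
  have h2 : Integrable fun x => d * g x + e * h x := (hg.const_mul d).add (hh.const_mul e)
  rw [integral_add (h1.const_mul a) (h2.const_mul c), integral_const_mul, integral_const_mul,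
    integral_add (hf.const_mul b) hg, integral_add (hg.const_mul d) (hh.const_mul e),
    integral_const_mul, integral_const_mul, integral_const_mul]

lemma bellman_flow {f F : E3 → ℝ} (hf : IsTest f) (hF : IsTest F) (hF0 : ∀ x, 0 ≤ F x)
    (i j : Fin 3) {γ : E3 → ℝ} (hγ : KernelPair γ γ) (hγ0 : ∀ y, 0 ≤ γ y) (hγ1 : ∫ y, γ y = 1)
    {κ θ S : ℝ} (hκ : 0 < κ) (hθ : |θ| ≤ 1 / 2) (hS : 0 ≤ S) {B : ℝ → E3 → ℝ}
    (hB : ∀ s x, B s x = (av γ s (slap f) x ^ 2 + av γ s F x + κ) *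
      √(av γ s (slap f) x ^ 2 + av γ s F x + κ) +
      θ * (av γ s F x * av γ s (pd i (pd j f)) x)) :
    ∫ x, (B S x - B 0 x) ≤ 0 := by
  have hU := hf.slap
  have hZ := (hf.pd j).pd i
  have hk := hγ.int
  have hkc := hγ.cont
  have cU := continuous_av hk hkc hU
  have cV := continuous_av hk hkc hF
  have cZ := continuous_av hk hkc hZ
  have cU' := continuous_av hk hkc hU.slap
  have cV' := continuous_av hk hkc hF.slap
  have cZ' := continuous_av hk hkc hZ.slap
  have hV0 : ∀ s x, 0 ≤ av γ s F x := fun s x =>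
    integral_nonneg fun y => mul_nonneg (hγ0 y) (hF0 _)
  set n : ℝ × E3 → ℝ := fun p => av γ p.1 (slap f) p.2 ^ 2 + av γ p.1 F p.2 + κ with hn
  have cn : Continuous n := by fun_prop
  have hn0 : ∀ p, 0 < n p := fun p => by
    have := hV0 p.1 p.2
    simp only [hn]; positivity
  set D : ℝ × E3 → ℝ := fun p => 3 / 2 * √(n p) * (2 * av γ p.1 (slap f) p.2 *
      av γ p.1 (slap (slap f)) p.2 + av γ p.1 (slap F) p.2) +
      θ * (av γ p.1 (slap F) p.2 * av γ p.1 (pd i (pd j f)) p.2 +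
        av γ p.1 F p.2 * av γ p.1 (slap (pd i (pd j f))) p.2) with hD
  have cD : Continuous D := by
    have := cn.sqrt
    fun_prop
  have hder : ∀ x s, HasDerivAt (fun s => B s x) (s * D (s, x)) s := fun x s => by
    have dU := hasDerivAt_av hγ hU x s
    have dV := hasDerivAt_av hγ hF x s
    have dZ := hasDerivAt_av hγ hZ x s
    have dn : HasDerivAt (fun s => n (s, x)) _ s := ((dU.pow 2).add dV).add_const κ
    have dr := dn.sqrt (hn0 (s, x)).ne'
    have h1 := (dn.mul dr).add ((dV.mul dZ).const_mul θ)
    have hr0 : 0 < √(n (s, x)) := Real.sqrt_pos.2 (hn0 _)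
    have hrr : n (s, x) = √(n (s, x)) ^ 2 := (Real.sq_sqrt (hn0 _).le).symm
    refine (h1.congr_deriv ?_).congr_of_eventuallyEq (Eventually.of_forall fun s => ?_)
    · simp only [hD]
      generalize √(n (s, x)) = r at hr0 hrr ⊢
      rw [hrr]
      field_simp
      ring
    · simp only [hB]; rfl
  have hFTC : ∀ x, B S x - B 0 x = ∫ s in 0..S, s * D (s, x) := fun x => by
    rw [intervalIntegral.integral_eq_sub_of_hasDerivAt (fun s _ => hder x s)]
    exact Continuous.intervalIntegrable (by fun_prop) _ _
  have hslice : ∀ s, ∫ x, D (s, x) ≤ 0 := fun s => by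
    refine bellman_static (nice_av hk hkc hU s) (nice_av hk hkc hF s) (nice_av hk hkc hZ s)
      (hV0 s) hκ hθ (i := i) (j := j) ?_ |>.trans_eq' ?_
    · rw [slap_av hk hZ, pd_av hk hU, pd_av hk (hU.pd j), slap_pd (contDiff_pd hf.smooth),
        slap_pd hf.smooth]
    · simp only [slap_av hk hU, slap_av hk hF, slap_av hk hZ, hD, hn]
  obtain ⟨CU, hCU0, hCU⟩ := hU.exists_bound
  obtain ⟨CV, hCV0, hCV⟩ := hF.exists_bound
  obtain ⟨CZ, hCZ0, hCZ⟩ := hZ.exists_bound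
  have habs1 : ∫ y, |γ y| = 1 := by simp only [abs_of_nonneg (hγ0 _), hγ1]
  have bd : ∀ {h : E3 → ℝ} {M : ℝ}, (∀ x, ‖h x‖ ≤ M) → ∀ s x, |av γ s h x| ≤ M :=
    fun {h M} hM s x => by
      have := norm_wavg_le (z := fun y : E3 => s • y) hk hM x
      rwa [habs1, one_mul] at this
  have bi : ∀ {h : E3 → ℝ}, IsTest h → ∀ s, ∫ x, |av γ s h x| ≤ ∫ x, |h x| := fun {h} hh s => by
    have := integral_abs_wavg_le hk (measurable_smul_E3 s) hh.continuous hh.integrable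
    rwa [habs1, one_mul] at this
  set R := √(CU ^ 2 + CV + κ) with hRdef
  have hnR : ∀ p, √(n p) ≤ R := fun p => Real.sqrt_le_sqrt (by
    have h1 := abs_le.1 (bd hCU p.1 p.2)
    have h2 := (abs_le.1 (bd hCV p.1 p.2)).2
    have h3 : av γ p.1 (slap f) p.2 ^ 2 ≤ CU ^ 2 := sq_le_sq' h1.1 h1.2
    simp only [hn]; linarith)
  set G : ℝ → E3 → ℝ := fun s x => 3 / 2 * R * (2 * CU * |av γ s (slap (slap f)) x| +
    |av γ s (slap F) x|) + 1 / 2 * (CZ * |av γ s (slap F) x| +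
      CV * |av γ s (slap (pd i (pd j f))) x|) with hG
  have hDG : ∀ s x, |D (s, x)| ≤ G s x := fun s x => by
    simp only [hD, hG]
    refine (abs_add_le _ _).trans (add_le_add ?_ ?_)
    · rw [abs_mul, abs_mul, abs_of_pos (by norm_num : (0 : ℝ) < 3 / 2),
        abs_of_nonneg (Real.sqrt_nonneg _)]
      gcongr
      · exact hnR _
      · refine (abs_add_le _ _).trans (add_le_add ?_ le_rfl)
        rw [abs_mul, abs_mul, abs_two]
        gcongr
        exact bd hCU s x
    · rw [abs_mul]
      gcongr
      refine (abs_add_le _ _).trans (add_le_add ?_ ?_)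
      · rw [abs_mul, mul_comm]
        gcongr
        exact bd hCZ s x
      · rw [abs_mul]
        gcongr
        exact bd hCV s x
  have i1 := fun s => (bddInt_av hk hkc hU.slap s).int.abs
  have i2 := fun s => (bddInt_av hk hkc hF.slap s).int.abs
  have i3 := fun s => (bddInt_av hk hkc hZ.slap s).int.abs
  have hGi : ∀ s, Integrable (G s) := fun s =>
    ((((i1 s).const_mul (2 * CU)).add (i2 s)).const_mul _).add
      ((((i2 s).const_mul CZ).add ((i3 s).const_mul CV)).const_mul _)
  have hGI : ∃ K, ∀ s, ∫ x, G s x ≤ K := by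
    refine ⟨3 / 2 * R * (2 * CU * (∫ x, |slap (slap f) x|) + ∫ x, |slap F x|) +
      1 / 2 * (CZ * (∫ x, |slap F x|) + CV * ∫ x, |slap (pd i (pd j f)) x|), fun s => ?_⟩
    have e : ∫ x, G s x = 3 / 2 * R * (2 * CU * (∫ x, |av γ s (slap (slap f)) x|) +
        ∫ x, |av γ s (slap F) x|) + 1 / 2 * (CZ * (∫ x, |av γ s (slap F) x|) +
        CV * ∫ x, |av γ s (slap (pd i (pd j f))) x|) := by
      exact integral_add_aux (i1 s) (i2 s) (i3 s) _ _ _ _ _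
    rw [e]
    have b1 := bi hU.slap s
    have b2 := bi hF.slap s
    have b3 := bi hZ.slap s
    gcongr
  obtain ⟨K, hK⟩ := hGI
  have hDi : ∀ s, Integrable fun x => D (s, x) := fun s =>
    (hGi s).mono' (Continuous.aestronglyMeasurable (by fun_prop))
      (Eventually.of_forall fun x => hDG s x)
  have hK0 : 0 ≤ K := (integral_nonneg fun x => (abs_nonneg _).trans (hDG 0 x)).trans (hK 0)
  have hprod : Integrable (fun p : ℝ × E3 => p.1 * D p)
      ((volume.restrict (Set.Ioc 0 S)).prod volume) := by
    have hm : AEStronglyMeasurable (fun p : ℝ × E3 => p.1 * D p)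
        ((volume.restrict (Set.Ioc 0 S)).prod volume) :=
      Continuous.aestronglyMeasurable (by fun_prop)
    rw [integrable_prod_iff hm]
    refine ⟨Eventually.of_forall fun s => (hDi s).const_mul s, ?_⟩
    have hI : Integrable (fun _ : ℝ => S * K) (volume.restrict (Set.Ioc 0 S)) :=
      integrable_const _
    refine hI.mono' hm.norm.integral_prod_right' ?_
    filter_upwards [ae_restrict_mem measurableSet_Ioc] with s hs
    rw [Real.norm_of_nonneg (integral_nonneg fun x => norm_nonneg _)]
    simp only [norm_mul, integral_const_mul, Real.norm_eq_abs, abs_of_pos hs.1]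
    refine mul_le_mul hs.2 ?_ (integral_nonneg fun x => abs_nonneg _) hS
    exact (integral_mono (hDi s).abs (hGi s) (hDG s)).trans (hK s)
  have hswap : ∫ x, (B S x - B 0 x) = ∫ s in Set.Ioc 0 S, ∫ x, s * D (s, x) := by
    rw [integral_integral_swap hprod]
    congr 1
    funext x
    rw [hFTC, intervalIntegral.integral_of_le hS]
  rw [hswap]
  refine setIntegral_nonpos measurableSet_Ioc fun s hs => ?_
  rw [integral_const_mul]
  exact mul_nonpos_of_nonneg_of_nonpos hs.1.le (hslice s)

lemma sqrt_cube_sub_le {a κ : ℝ} (ha : 0 ≤ a) (hκ : 0 ≤ κ) :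
    0 ≤ (a + κ) * √(a + κ) - κ * √κ ∧
      (a + κ) * √(a + κ) - κ * √κ ≤ 3 / 2 * (√(a + κ) * a) := by
  set r := √(a + κ)
  set t := √κ
  have hr : r ^ 2 = a + κ := Real.sq_sqrt (by positivity)
  have ht : t ^ 2 = κ := Real.sq_sqrt hκ
  have htr : t ≤ r := Real.sqrt_le_sqrt (by linarith)
  have ht0 : 0 ≤ t := Real.sqrt_nonneg _
  have ea : a = r ^ 2 - t ^ 2 := by linarith
  rw [← hr, ← ht, ea]
  constructor
  · have : t ^ 2 * t ≤ r ^ 2 * r := by gcongr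
    linarith
  · nlinarith [mul_nonneg (sub_nonneg.2 htr) (mul_nonneg (sub_nonneg.2 htr)
      (by positivity : 0 ≤ r + 2 * t))]

lemma sqrt_cube_le {h F κ : ℝ} (hF : 0 ≤ F) (hκ : 0 ≤ κ) :
    √(h ^ 2 + F + κ) * (h ^ 2 + F) ≤ 2 * (|h| ^ 3 + F * √F) + √κ * (h ^ 2 + F) := by
  set β := √F
  have hβ : β ^ 2 = F := Real.sq_sqrt hF
  have hβ0 : 0 ≤ β := Real.sqrt_nonneg _
  have hα0 : 0 ≤ |h| := abs_nonneg h
  have hκ' : √κ ^ 2 = κ := Real.sq_sqrt hκ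
  have hκ0 := Real.sqrt_nonneg κ
  have h1 : √(h ^ 2 + F + κ) ≤ |h| + β + √κ := by
    refine Real.sqrt_le_iff.2 ⟨by positivity, ?_⟩
    have : 0 ≤ |h| * β + |h| * √κ + β * √κ := by positivity
    nlinarith [sq_abs h]
  have h2 : (|h| + β) * (|h| ^ 2 + β ^ 2) ≤ 2 * (|h| ^ 3 + β ^ 3) := by
    nlinarith [mul_nonneg (add_nonneg hα0 hβ0) (sq_nonneg (|h| - β))]
  calc √(h ^ 2 + F + κ) * (h ^ 2 + F) ≤ (|h| + β + √κ) * (h ^ 2 + F) := by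
        gcongr
    _ = (|h| + β) * (|h| ^ 2 + β ^ 2) + √κ * (h ^ 2 + F) := by rw [sq_abs, hβ]; ring
    _ ≤ 2 * (|h| ^ 3 + β ^ 3) + √κ * (h ^ 2 + F) := by linarith
    _ = _ := by rw [pow_succ β 2, hβ]

lemma IsTest.bddInt {h : E3 → ℝ} (hh : IsTest h) : BddInt h := by
  obtain ⟨C, -, hC⟩ := hh.exists_bound
  exact ⟨hh.continuous, hh.integrable, C, hC⟩

lemma IsTest.integrable_abs_cube {h : E3 → ℝ} (hh : IsTest h) : Integrable fun x => |h x| ^ 3 := by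
  have h1 := (hh.bddInt.mul (hh.bddInt.mul hh.bddInt)).int.abs
  refine h1.congr (Eventually.of_forall fun x => ?_)
  simp only [abs_mul]
  ring

lemma IsTest.integrable_mul_sqrt {h : E3 → ℝ} (hh : IsTest h) :
    Integrable fun x => h x * √(h x) :=
  (hh.continuous.mul hh.continuous.sqrt).integrable_of_hasCompactSupport hh.supp.mul_right

lemma hessian_pairing_aux {f F : E3 → ℝ} (hf : IsTest f) (hF : IsTest F) (hF0 : ∀ x, 0 ≤ F x)
    (i j : Fin 3) {θ : ℝ} (hθ : |θ| ≤ 1 / 2) :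
    -(θ * ∫ x, F x * pd i (pd j f) x) ≤ 3 * ∫ x, (|slap f x| ^ 3 + F x * √(F x)) := by
  obtain ⟨γ, hγ, hγ0, hγ1, M, hγM⟩ := exists_gaussian
  have hU := hf.slap
  have hZ := (hf.pd j).pd i
  have hk := hγ.int
  have hkc := hγ.cont
  have iC : Integrable fun x => |slap f x| ^ 3 + F x * √(F x) :=
    hU.integrable_abs_cube.add hF.integrable_mul_sqrt
  have iA : Integrable fun x => slap f x ^ 2 + F x := by
    refine ((hU.bddInt.mul hU.bddInt).add hF.bddInt).int.congr (Eventually.of_forall fun x => ?_)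
    simp only; ring
  have iFZ : Integrable fun x => F x * pd i (pd j f) x := (hF.bddInt.mul hZ.bddInt).int
  have habs1 : ∫ y, |γ y| = 1 := by simp only [abs_of_nonneg (hγ0 _), hγ1]
  have hM0 : 0 ≤ M := (hγ0 0).trans (hγM 0)
  have main : ∀ t > (0 : ℝ), -(θ * ∫ x, F x * pd i (pd j f) x) ≤
      3 * (∫ x, (|slap f x| ^ 3 + F x * √(F x))) +
      (t * (3 / 2 * ∫ x, (slap f x ^ 2 + F x)) +
        t ^ 3 * (1 / 2 * ((M * ∫ x, |F x|) * ∫ x, |pd i (pd j f) x|))) := by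
    intro t ht
    set κ := t ^ 2 with hκdef
    have hκ : 0 < κ := by positivity
    have hsκ : √κ = t := Real.sqrt_sq ht.le
    set B : ℝ → E3 → ℝ := fun s x => (av γ s (slap f) x ^ 2 + av γ s F x + κ) *
      √(av γ s (slap f) x ^ 2 + av γ s F x + κ) +
      θ * (av γ s F x * av γ s (pd i (pd j f)) x) with hB
    have hflow := bellman_flow hf hF hF0 i j hγ hγ0 hγ1 hκ hθ (S := t⁻¹) (by positivity)
      (B := B) fun s x => rfl
    set b : ℝ → E3 → ℝ := fun s x => (av γ s (slap f) x ^ 2 + av γ s F x + κ) *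
      √(av γ s (slap f) x ^ 2 + av γ s F x + κ) - κ * √κ with hb
    have hV0 : ∀ s x, 0 ≤ av γ s F x := fun s x =>
      integral_nonneg fun y => mul_nonneg (hγ0 y) (hF0 _)
    have ha0 : ∀ s x, 0 ≤ av γ s (slap f) x ^ 2 + av γ s F x := fun s x =>
      add_nonneg (sq_nonneg _) (hV0 s x)
    have hb0 : ∀ s x, 0 ≤ b s x := fun s x => (sqrt_cube_sub_le (ha0 s x) hκ.le).1
    have hb1 : ∀ s x, b s x ≤ 3 / 2 * (√(av γ s (slap f) x ^ 2 + av γ s F x + κ) *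
      (av γ s (slap f) x ^ 2 + av γ s F x)) := fun s x => (sqrt_cube_sub_le (ha0 s x) hκ.le).2
    have bU := bddInt_av hk hkc hU
    have bV := bddInt_av hk hkc hF
    have bZ := bddInt_av hk hkc hZ
    have ba : ∀ s, BddInt fun x => av γ s (slap f) x ^ 2 + av γ s F x := fun s => by
      have := ((bU s).mul (bU s)).add (bV s)
      simpa only [sq] using this
    have cr : ∀ s, Continuous fun x => √(av γ s (slap f) x ^ 2 + av γ s F x + κ) := fun s =>
      ((ba s).cont.add continuous_const).sqrt
    have bi : ∀ s, Integrable (b s) := fun s => by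
      obtain ⟨C, hC⟩ := (ba s).bdd
      have h1 : BddInt fun x => √(av γ s (slap f) x ^ 2 + av γ s F x + κ) *
          (av γ s (slap f) x ^ 2 + av γ s F x) :=
        (ba s).mul_left (C := √(C + κ)) (cr s) fun x => by
          rw [abs_of_nonneg (Real.sqrt_nonneg _)]
          exact Real.sqrt_le_sqrt (by linarith [le_abs_self _ |>.trans (hC x)])
      refine (h1.int.const_mul (3 / 2)).mono' ?_ (Eventually.of_forall fun x => ?_)
      · exact (((((ba s).cont.add continuous_const).mul (cr s)).sub
          continuous_const)).aestronglyMeasurable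
      · rw [Real.norm_of_nonneg (hb0 s x)]
        exact hb1 s x
    have iVZ : ∀ s, Integrable fun x => av γ s F x * av γ s (pd i (pd j f)) x := fun s =>
      ((bV s).mul (bZ s)).int
    have hJ : ∫ x, (B t⁻¹ x - B 0 x) =
        ((∫ x, b t⁻¹ x) + θ * ∫ x, av γ t⁻¹ F x * av γ t⁻¹ (pd i (pd j f)) x) -
        ((∫ x, b 0 x) + θ * ∫ x, F x * pd i (pd j f) x) := by
      have i1 : Integrable fun x => b t⁻¹ x +
          θ * (av γ t⁻¹ F x * av γ t⁻¹ (pd i (pd j f)) x) := (bi _).add ((iVZ _).const_mul θ)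
      have i2 : Integrable fun x => b 0 x + θ * (F x * pd i (pd j f) x) :=
        (bi _).add (iFZ.const_mul θ)
      rw [← integral_const_mul, ← integral_const_mul,
        ← integral_add (bi _) ((iVZ _).const_mul θ), ← integral_add (bi _) (iFZ.const_mul θ),
        ← integral_sub i1 i2]
      congr 1
      funext x
      simp only [hB, hb, av_zero hγ1]
      ring
    have hJS : -(t ^ 3 * (1 / 2 * ((M * ∫ x, |F x|) * ∫ x, |pd i (pd j f) x|))) ≤
        (∫ x, b t⁻¹ x) + θ * ∫ x, av γ t⁻¹ F x * av γ t⁻¹ (pd i (pd j f)) x := by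
      have h1 : 0 ≤ ∫ x, b t⁻¹ x := integral_nonneg (hb0 _)
      have h2 : |∫ x, av γ t⁻¹ F x * av γ t⁻¹ (pd i (pd j f)) x| ≤
          (t ^ 3 * (M * ∫ x, |F x|)) * ∫ x, |pd i (pd j f) x| := by
        calc |∫ x, av γ t⁻¹ F x * av γ t⁻¹ (pd i (pd j f)) x|
            ≤ ∫ x, (t ^ 3 * (M * ∫ x, |F x|)) * |av γ t⁻¹ (pd i (pd j f)) x| := by
              rw [← Real.norm_eq_abs]
              refine norm_integral_le_of_norm_le ((bZ _).int.abs.const_mul _)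
                (Eventually.of_forall fun x => ?_)
              rw [norm_mul, Real.norm_eq_abs, Real.norm_eq_abs]
              refine mul_le_mul_of_nonneg_right ?_ (abs_nonneg _)
              refine (abs_av_le_inv_cube hγ0 hγM hF (inv_pos.2 ht) x).trans (le_of_eq ?_)
              rw [inv_pow, inv_inv]; ring
          _ ≤ _ := by
              rw [integral_const_mul]
              have h3 := integral_abs_wavg_le hk (measurable_smul_E3 t⁻¹) hZ.continuous
                hZ.integrable
              rw [habs1, one_mul] at h3
              refine mul_le_mul_of_nonneg_left h3 ?_
              have : 0 ≤ ∫ x, |F x| := integral_nonneg fun x => abs_nonneg _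
              positivity
      have h3 : |θ * ∫ x, av γ t⁻¹ F x * av γ t⁻¹ (pd i (pd j f)) x| ≤
          1 / 2 * ((t ^ 3 * (M * ∫ x, |F x|)) * ∫ x, |pd i (pd j f) x|) := by
        rw [abs_mul]
        exact mul_le_mul hθ h2 (abs_nonneg _) (by norm_num)
      have := (abs_le.1 h3).1
      linarith
    have hJ0 : ∫ x, b 0 x ≤ 3 * (∫ x, (|slap f x| ^ 3 + F x * √(F x))) +
        t * (3 / 2 * ∫ x, (slap f x ^ 2 + F x)) := by
      rw [← integral_const_mul, ← integral_const_mul (3 / 2), ← integral_const_mul t,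
        ← integral_add (iC.const_mul 3) ((iA.const_mul (3 / 2)).const_mul t)]
      refine integral_mono (bi 0) ((iC.const_mul 3).add ((iA.const_mul (3 / 2)).const_mul t))
        fun x => ?_
      have h1 := hb1 0 x
      simp only [av_zero hγ1] at h1
      have h2 := sqrt_cube_le (h := slap f x) (hF0 x) hκ.le
      rw [hsκ] at h2
      linarith
    rw [hJ] at hflow
    linarith
  have hlim : Tendsto (fun t : ℝ => 3 * (∫ x, (|slap f x| ^ 3 + F x * √(F x))) +
      (t * (3 / 2 * ∫ x, (slap f x ^ 2 + F x)) +
        t ^ 3 * (1 / 2 * ((M * ∫ x, |F x|) * ∫ x, |pd i (pd j f) x|))))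
      (nhdsWithin 0 (Set.Ioi 0)) (nhds (3 * ∫ x, (|slap f x| ^ 3 + F x * √(F x)))) := by
    refine Tendsto.mono_left (Continuous.tendsto' (by fun_prop) _ _ ?_) nhdsWithin_le_nhds
    simp
  exact ge_of_tendsto hlim (eventually_nhdsWithin_of_forall main)

lemma hessian_pairing {f F : E3 → ℝ} (hf : IsTest f) (hF : IsTest F) (hF0 : ∀ x, 0 ≤ F x)
    (i j : Fin 3) : |∫ x, F x * pd i (pd j f) x| ≤
      6 * ((∫ x, |slap f x| ^ 3) + ∫ x, F x * √(F x)) := by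
  have h1 := hessian_pairing_aux hf hF hF0 i j (θ := 1 / 2) (by norm_num)
  have h2 := hessian_pairing_aux hf hF hF0 i j (θ := -(1 / 2)) (by norm_num)
  rw [integral_add hf.slap.integrable_abs_cube hF.integrable_mul_sqrt] at h1 h2
  rw [abs_le]
  constructor <;> linarith

/-- A Calderón–Zygmund type bound for the pairing of a function with a Hessian entry. -/
lemma abs_integral_mul_hessian_le {f F M : E3 → ℝ} (hf : IsTest f) (hF : IsTest F)
    (hM : IsTest M) (hFM : ∀ x, |F x| ≤ M x) (i j : Fin 3) :
    |∫ x, F x * pd i (pd j f) x| ≤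
      12 * (∫ x, |slap f x| ^ 3) + 30 * ∫ x, M x * √(M x) := by
  have hM0 : ∀ x, 0 ≤ M x := fun x => (abs_nonneg _).trans (hFM x)
  have hFM0 : ∀ x, 0 ≤ F x + M x := fun x => by linarith [(abs_le.1 (hFM x)).1]
  have hZ := (hf.pd j).pd i
  have h1 := hessian_pairing hf (hF.add hM) hFM0 i j
  have h2 := hessian_pairing hf hM hM0 i j
  have e : ∫ x, F x * pd i (pd j f) x =
      (∫ x, (F x + M x) * pd i (pd j f) x) - ∫ x, M x * pd i (pd j f) x := by
    rw [← integral_sub ((hF.add hM).bddInt.mul hZ.bddInt).int (hM.bddInt.mul hZ.bddInt).int]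
    congr 1; funext x; ring
  have h3 : ∫ x, (F x + M x) * √(F x + M x) ≤ 4 * ∫ x, M x * √(M x) := by
    rw [← integral_const_mul]
    refine integral_mono (hF.add hM).integrable_mul_sqrt (hM.integrable_mul_sqrt.const_mul 4)
      fun x => ?_
    have a1 : F x + M x ≤ 2 * M x := by linarith [(abs_le.1 (hFM x)).2]
    have a2 : √(F x + M x) ≤ 2 * √(M x) := by
      refine Real.sqrt_le_iff.2 ⟨by positivity, ?_⟩
      rw [mul_pow, Real.sq_sqrt (hM0 x)]
      linarith [hM0 x]
    calc (F x + M x) * √(F x + M x) ≤ (2 * M x) * (2 * √(M x)) :=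
          mul_le_mul a1 a2 (Real.sqrt_nonneg _) (by linarith [hM0 x])
      _ = _ := by ring
  rw [e]
  refine (abs_sub _ _).trans ?_
  linarith

lemma exists_local_inverse_laplacian {k κ g : E3 → ℝ} {δ : ℝ} (hk : KernelPair k κ)
    (hk1 : ∫ y, k y = 1) (hκ0 : ∀ y, δ ≤ ‖y‖ → κ y = 0) (hg : IsTest g) :
    ∃ f : E3 → ℝ, IsTest f ∧ (∀ x, slap f x = g x - av k 1 g x) ∧
      ∀ x, (∀ y : E3, ‖y‖ < δ → g (x + y) = 0) → f x = 0 := by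
  set ν : Measure (ℝ × E3) := (volume.restrict (Set.Ioc (0 : ℝ) 1)).prod volume with hν
  set c : ℝ × E3 → ℝ := fun q => (-q.1) * κ q.2 with hc
  set z : ℝ × E3 → E3 := fun q => q.1 • q.2 with hz
  have hs : Integrable (fun s : ℝ => -s) (volume.restrict (Set.Ioc (0 : ℝ) 1)) :=
    (continuous_neg.integrableOn_Icc (a := (0 : ℝ)) (b := 1)).mono_set Set.Ioc_subset_Icc_self
  have ci : Integrable c ν := hs.mul_prod hk.int'
  have zm : Measurable z := by fun_prop
  have hzero : ∀ x, (∀ y : E3, ‖y‖ < δ → g (x + y) = 0) → wavg ν c z g x = 0 := fun x hx => by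
    unfold wavg
    have hae : ∀ᵐ q ∂ν, q.1 ∈ Set.Ioc (0 : ℝ) 1 := by
      have := (Measure.quasiMeasurePreserving_fst (μ := volume.restrict (Set.Ioc (0 : ℝ) 1))
        (ν := (volume : Measure E3))).ae (p := fun s => s ∈ Set.Ioc (0 : ℝ) 1)
        (ae_restrict_mem measurableSet_Ioc)
      exact this
    refine integral_eq_zero_of_ae ?_
    filter_upwards [hae] with q hq
    by_cases hy : δ ≤ ‖q.2‖
    · simp [hc, hκ0 _ hy]
    · have : ‖q.1 • q.2‖ < δ := by
        rw [norm_smul, Real.norm_of_nonneg hq.1.le]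
        nlinarith [norm_nonneg q.2, hq.2]
      simp [hz, hx _ this]
  refine ⟨wavg ν c z g, ⟨contDiff_wavg ci zm hg, ?_⟩, fun x => ?_, hzero⟩
  · obtain ⟨R, hR⟩ := hg.supp.isCompact.isBounded.subset_closedBall (0 : E3)
    refine HasCompactSupport.intro (isCompact_closedBall (0 : E3) (R + δ)) fun x hx => ?_
    refine hzero x fun y hy => ?_
    refine image_eq_zero_of_notMem_tsupport fun hmem => hx ?_
    have h1 := hR hmem
    simp only [mem_closedBall, dist_zero_right] at h1 ⊢
    have h2 : ‖x‖ ≤ ‖x + y‖ + ‖y‖ := by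
      simpa using norm_sub_le (x + y) y
    linarith
  · obtain ⟨M, -, hM⟩ := hg.slap.exists_bound
    rw [slap_wavg ci zm hg]
    have hwi := wavg_integrable ci zm hg.slap.continuous hM x
    have h1 : wavg ν c z (slap g) x = ∫ s in Set.Ioc (0 : ℝ) 1, - (s * av κ s (slap g) x) := by
      unfold wavg
      rw [hν, integral_prod _ hwi]
      congr 1
      funext s
      simp only [hc, hz, smul_eq_mul, av, wavg]
      rw [← integral_const_mul, ← integral_neg]
      congr 1
      funext y
      ring
    have h2 := intervalIntegral.integral_eq_sub_of_hasDerivAt (a := 0) (b := 1)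
      (fun s _ => hasDerivAt_av hk hg x s) (by
        have := (continuous_av hk.int' hk.smooth.continuous hg.slap).comp
          (by fun_prop : Continuous fun s : ℝ => (s, x))
        simp only [Function.comp_def] at this
        exact Continuous.intervalIntegrable (by fun_prop) _ _)
    rw [h1, integral_neg, ← intervalIntegral.integral_of_le zero_le_one, h2, av_zero hk1]
    ring

/-- Smooth solutions of the steady Navier–Stokes system, written in components. -/
structure IsNS (u : Fin 3 → E3 → ℝ) (p : E3 → ℝ) : Prop where
  smooth : ∀ i, ContDiff ℝ ∞ (u i)
  smooth_p : ContDiff ℝ ∞ p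
  eq : ∀ i x, - slap (u i) x + ∑ j, u j x * pd j (u i) x + pd i p x = 0
  div : ∀ x, ∑ i, pd i (u i) x = 0

namespace IsNS

variable {u : Fin 3 → E3 → ℝ} {p : E3 → ℝ}

lemma integral_pressure_pd (h : IsNS u p) {w : E3 → ℝ} (hw : IsTest w) (i : Fin 3) :
    ∫ x, p x * pd i w x = - (∫ x, u i x * slap w x) - ∑ j, ∫ x, u i x * u j x * pd j w x := by
  have su := h.smooth
  have hconv : ∑ j, ∫ x, u i x * u j x * pd j w x =
      - ∫ x, (∑ j, u j x * pd j (u i) x) * w x := by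
    have e1 : ∀ j, ∫ x, u i x * u j x * pd j w x =
        - ∫ x, (pd j (u i) x * u j x + u i x * pd j (u j) x) * w x := fun j => by
      have := integral_mul_pd (i := j) (f := fun x => u i x * u j x)
        ((su i).mul (su j)) hw
      rw [this]
      congr 2
      funext x
      rw [pd_mul (su i) (su j)]
    simp only [e1]
    rw [Finset.sum_neg_distrib, ← integral_finsetSum]
    · congr 2
      funext x
      have hd := h.div x
      simp only [Fin.sum_univ_three] at hd ⊢
      linear_combination (u i x * w x) * hd
    · intro j _
      have := su i
      have := su j
      exact (hw.mul_left (g := fun x => pd j (u i) x * u j x + u i x * pd j (u j) x)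
        (by fun_prop)).integrable
  rw [integral_mul_pd h.smooth_p hw, integral_mul_slap (su i) hw, hconv, sub_neg_eq_add,
    ← integral_neg, ← integral_neg, ← integral_add]
  · congr 1
    funext x
    linear_combination (- w x) * h.eq i x
  · exact (hw.mul_left (contDiff_slap (su i))).integrable.neg
  · refine (hw.mul_left (g := fun x => ∑ j, u j x * pd j (u i) x) ?_).integrable
    exact ContDiff.sum fun j _ => (su j).mul (contDiff_pd (su i))

lemma integral_pressure_slap (h : IsNS u p) {f : E3 → ℝ} (hf : IsTest f) :
    ∫ x, p x * slap f x = - ∑ i, ∑ j, ∫ x, u i x * u j x * pd j (pd i f) x := by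
  have su := h.smooth
  have e0 : ∑ i, ∫ x, u i x * slap (pd i f) x = 0 := by
    have e1 : ∀ i, ∫ x, u i x * slap (pd i f) x = - ∫ x, pd i (u i) x * slap f x := fun i => by
      rw [slap_pd hf.smooth, integral_mul_pd (su i) hf.slap]
    simp only [e1]
    rw [Finset.sum_neg_distrib, ← integral_finsetSum]
    · simp only [← Finset.sum_mul, h.div]
      simp
    · intro i _
      exact (hf.slap.mul_left (contDiff_pd (su i))).integrable
  have e2 : ∫ x, p x * slap f x = ∑ i, ∫ x, p x * pd i (pd i f) x := by
    unfold slap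
    simp only [Finset.mul_sum]
    exact integral_finsetSum _ fun i _ => (((hf.pd i).pd i).mul_left h.smooth_p).integrable
  rw [e2, Finset.sum_congr rfl fun i _ => h.integral_pressure_pd (hf.pd i) i,
    Finset.sum_sub_distrib, Finset.sum_neg_distrib, e0]
  simp

/-- The flux weight `div (φ u) = u · ∇φ` attached to a cutoff. -/
def flux (u : Fin 3 → E3 → ℝ) (φ : E3 → ℝ) (x : E3) : ℝ := ∑ i, u i x * pd i φ x

lemma isTest_flux (h : IsNS u p) {φ : E3 → ℝ} (hφ : IsTest φ) : IsTest (flux u φ) :=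
  IsTest.sum fun i _ => (hφ.pd i).mul_left (h.smooth i)

lemma flux_eq (h : IsNS u p) {φ : E3 → ℝ} (hφ : IsTest φ) (x : E3) :
    flux u φ x = ∑ i, pd i (fun y => φ y * u i y) x := by
  simp only [pd_mul hφ.smooth (h.smooth _), Finset.sum_add_distrib, ← Finset.mul_sum, h.div, flux]
  simp [mul_comm]

lemma integral_mul_flux (h : IsNS u p) {φ e : E3 → ℝ} (hφ : IsTest φ) (he : ContDiff ℝ ∞ e) :
    ∫ x, e x * flux u φ x = - ∫ x, φ x * ∑ i, u i x * pd i e x := by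
  have ht : ∀ i, IsTest fun y => φ y * u i y := fun i => hφ.mul_right (h.smooth i)
  simp only [h.flux_eq hφ, Finset.mul_sum]
  rw [integral_finsetSum _ fun i _ => (((ht i).pd i).mul_left he).integrable,
    integral_finsetSum, ← Finset.sum_neg_distrib]
  · refine Finset.sum_congr rfl fun i _ => ?_
    rw [integral_mul_pd he (ht i)]
    congr 2
    funext x
    ring
  · intro i _
    exact (hφ.mul_right ((h.smooth i).mul (contDiff_pd he))).integrable

lemma integral_flux (h : IsNS u p) {φ : E3 → ℝ} (hφ : IsTest φ) : ∫ x, flux u φ x = 0 := by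
  have := h.integral_mul_flux hφ (e := fun _ => 1) contDiff_const
  simpa [pd] using this

lemma energy_identity (h : IsNS u p) {φ : E3 → ℝ} (hφ : IsTest φ) :
    ∫ x, φ x * ∑ i, ∑ j, (pd j (u i) x) ^ 2 =
      1 / 2 * (∫ x, (∑ i, u i x ^ 2) * slap φ x) +
      1 / 2 * (∫ x, (∑ i, u i x ^ 2) * flux u φ x) + ∫ x, p x * flux u φ x := by
  have su := h.smooth
  have sp := h.smooth_p
  have se : ContDiff ℝ ∞ fun x => ∑ i, u i x ^ 2 := ContDiff.sum fun i _ => (su i).pow 2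
  have pde : ∀ m x, pd m (fun x => ∑ i, u i x ^ 2) x = ∑ i, 2 * (u i x * pd m (u i) x) :=
    fun m x => by
      simp only [sq]
      rw [pd_sum fun i _ => (su i).mul (su i)]
      refine Finset.sum_congr rfl fun i _ => ?_
      rw [pd_mul (su i) (su i)]; ring
  have slape : ∀ x, slap (fun x => ∑ i, u i x ^ 2) x =
      2 * (∑ i, ∑ j, (pd j (u i) x) ^ 2) + 2 * ∑ i, u i x * slap (u i) x := fun x => by
    have s1 : ∀ m i, ContDiff ℝ ∞ fun x => u i x * pd m (u i) x := fun m i =>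
      (su i).mul (contDiff_pd (su i))
    have e : ∀ m, pd m (pd m fun x => ∑ i, u i x ^ 2) x =
        ∑ i, 2 * ((pd m (u i) x) ^ 2 + u i x * pd m (pd m (u i)) x) := fun m => by
      rw [show (pd m fun x => ∑ i, u i x ^ 2) = _ from funext (pde m),
        pd_sum fun i _ => contDiff_const.mul (s1 m i)]
      refine Finset.sum_congr rfl fun i _ => ?_
      rw [pd_mul contDiff_const (s1 m i), pd_mul (su i) (contDiff_pd (su i))]
      simp [pd]
      ring
    unfold slap
    rw [Finset.sum_congr rfl fun m _ => e m]
    simp only [Fin.sum_univ_three]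
    ring
  rw [integral_mul_slap se hφ, h.integral_mul_flux hφ se, h.integral_mul_flux hφ sp]
  simp only [slape, pde]
  have c1 : ∀ i, Continuous (u i) := fun i => (su i).continuous
  have c2 : ∀ i j, Continuous (pd j (u i)) := fun i j => (contDiff_pd (su i)).continuous
  have c3 : ∀ i, Continuous (slap (u i)) := fun i => (contDiff_slap (su i)).continuous
  have c4 : ∀ i, Continuous (pd i p) := fun i => (contDiff_pd sp).continuous
  have c5 := hφ.continuous
  have int : ∀ {w : E3 → ℝ}, Continuous w → Integrable (fun x => φ x * w x) := fun {w} hw =>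
    (c5.mul hw).integrable_of_hasCompactSupport hφ.supp.mul_right
  have i1 : Integrable fun x => (2 * (∑ i, ∑ j, (pd j (u i) x) ^ 2) +
      2 * ∑ i, u i x * slap (u i) x) * φ x := by
    simp only [mul_comm _ (φ _)]
    exact int (by fun_prop)
  have i2 : Integrable fun x => φ x * ∑ m, u m x * ∑ i, 2 * (u i x * pd m (u i) x) :=
    int (by fun_prop)
  have i3 : Integrable fun x => φ x * ∑ i, u i x * pd i p x := int (by fun_prop)
  rw [← integral_neg, ← integral_neg, ← integral_const_mul, ← integral_const_mul]
  have i2' : Integrable fun x => 1 / 2 * -(φ x * ∑ m, u m x * ∑ i, 2 * (u i x * pd m (u i) x)) :=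
    i2.neg.const_mul _
  have i12 : Integrable fun x => 1 / 2 * ((2 * (∑ i, ∑ j, (pd j (u i) x) ^ 2) +
      2 * ∑ i, u i x * slap (u i) x) * φ x) +
      1 / 2 * -(φ x * ∑ m, u m x * ∑ i, 2 * (u i x * pd m (u i) x)) := (i1.const_mul _).add i2'
  have i3' : Integrable fun x => -(φ x * ∑ i, u i x * pd i p x) := i3.neg
  rw [← integral_add (i1.const_mul _) i2', ← integral_add i12 i3']
  congr 1
  funext x
  have e0 := h.eq 0 x
  have e1 := h.eq 1 x
  have e2 := h.eq 2 x
  simp only [Fin.sum_univ_three] at *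
  linear_combination (φ x * u 0 x) * e0 + (φ x * u 1 x) * e1 + (φ x * u 2 x) * e2

end IsNS

lemma pd_eq_zero_of_isOpen {s : Set E3} (hs : IsOpen s) {h : E3 → ℝ} {c : ℝ}
    (hh : ∀ x ∈ s, h x = c) (i : Fin 3) : ∀ x ∈ s, pd i h x = 0 := fun x hx => by
  have : h =ᶠ[nhds x] fun _ => c := by
    filter_upwards [hs.mem_nhds hx] with y hy using hh y hy
  unfold pd
  rw [this.fderiv_eq]
  simp

lemma slap_eq_zero_of_isOpen {s : Set E3} (hs : IsOpen s) {h : E3 → ℝ} {c : ℝ}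
    (hh : ∀ x ∈ s, h x = c) : ∀ x ∈ s, slap h x = 0 := fun x hx =>
  Finset.sum_eq_zero fun i _ => pd_eq_zero_of_isOpen hs (pd_eq_zero_of_isOpen hs hh i) i x hx

lemma pd_comp_sub (h : E3 → ℝ) (x : E3) (i : Fin 3) :
    pd i (fun y => h (y - x)) = fun y => pd i h (y - x) := by
  funext y
  unfold pd
  simp only [sub_eq_add_neg]
  rw [fderiv_comp_add_right]

lemma slap_comp_sub (h : E3 → ℝ) (x : E3) :
    slap (fun y => h (y - x)) = fun y => slap h (y - x) := by
  funext y
  simp only [slap, pd_comp_sub]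

lemma IsTest.comp_sub {h : E3 → ℝ} (hh : IsTest h) (x : E3) : IsTest fun y => h (y - x) :=
  ⟨hh.smooth.comp (by fun_prop), hh.supp.comp_homeomorph (Homeomorph.subRight x)⟩

lemma measurableSet_ann (R : ℝ) : MeasurableSet (ann R) :=
  measurableSet_ball.diff measurableSet_ball

lemma mem_ann {R : ℝ} {x : E3} : x ∈ ann R ↔ ‖x‖ < R ∧ R / 2 ≤ ‖x‖ := by
  simp [ann]

lemma Continuous.integrableOn_ann {v : E3 → ℝ} (hv : Continuous v) (R : ℝ) :
    IntegrableOn v (ann R) :=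
  (hv.continuousOn.integrableOn_compact (isCompact_closedBall (0 : E3) R)).mono_set
    (Set.sdiff_subset.trans ball_subset_closedBall)

lemma abs_integral_le_of_ann {w v : E3 → ℝ} (hv : Continuous v) {C : ℝ}
    (h0 : ∀ x, x ∉ ann 1 → w x = 0) (h1 : ∀ x ∈ ann 1, |w x| ≤ C * v x) :
    |∫ x, w x| ≤ C * ∫ x in ann 1, v x := by
  rw [← setIntegral_eq_integral_of_forall_compl_eq_zero h0, ← integral_const_mul,
    ← Real.norm_eq_abs]
  refine norm_integral_le_of_norm_le ((hv.integrableOn_ann 1).const_mul C) ?_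
  filter_upwards [ae_restrict_mem (measurableSet_ann 1)] with x hx using h1 x hx

/-- Pointwise squared length of a vector field given by its components. -/
def lenSq (u : Fin 3 → E3 → ℝ) (x : E3) : ℝ := ∑ i, u i x ^ 2

lemma lenSq_nonneg (u : Fin 3 → E3 → ℝ) (x : E3) : 0 ≤ lenSq u x :=
  Finset.sum_nonneg fun _ _ => sq_nonneg _

lemma abs_le_sqrt_lenSq (u : Fin 3 → E3 → ℝ) (i : Fin 3) (x : E3) :
    |u i x| ≤ √(lenSq u x) :=
  Real.abs_le_sqrt (Finset.single_le_sum (f := fun i => u i x ^ 2)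
    (fun _ _ => sq_nonneg _) (Finset.mem_univ i))

lemma abs_mul_le_lenSq (u : Fin 3 → E3 → ℝ) (i j : Fin 3) (x : E3) :
    |u i x * u j x| ≤ lenSq u x := by
  rw [abs_mul, ← Real.mul_self_sqrt (lenSq_nonneg u x)]
  exact mul_le_mul (abs_le_sqrt_lenSq u i x) (abs_le_sqrt_lenSq u j x) (abs_nonneg _)
    (Real.sqrt_nonneg _)

lemma continuous_lenSq {u : Fin 3 → E3 → ℝ} (hu : ∀ i, Continuous (u i)) :
    Continuous (lenSq u) := continuous_finsetSum _ fun i _ => (hu i).pow 2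

lemma integral_ann_le {s : E3 → ℝ} (hs : Continuous s) (hs0 : ∀ x, 0 ≤ s x) {a : ℝ} (ha : 0 < a)
    (h : ∫ x in ann 1, s x * √(s x) ≤ a ^ 3) :
    ∫ x in ann 1, s x ≤ (1 + volume.real (ann 1)) * a ^ 2 ∧
      ∫ x in ann 1, √(s x) ≤ (1 + volume.real (ann 1)) * a := by
  have i0 : IntegrableOn (fun x => s x * √(s x)) (ann 1) := (hs.mul hs.sqrt).integrableOn_ann 1
  have ic : ∀ c : ℝ, IntegrableOn (fun _ => c) (ann 1) := fun c =>
    continuous_const.integrableOn_ann 1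
  have key : ∀ t : ℝ, 0 ≤ t → t ^ 2 ≤ a⁻¹ * (t ^ 2 * t) + a ^ 2 ∧
      t ≤ (a ^ 2)⁻¹ * (t ^ 2 * t) + a := fun t ht => by
    rcases le_total t a with hta | hta
    · constructor
      · have : t ^ 2 ≤ a ^ 2 := by gcongr
        have : 0 ≤ a⁻¹ * (t ^ 2 * t) := by positivity
        linarith
      · have : 0 ≤ (a ^ 2)⁻¹ * (t ^ 2 * t) := by positivity
        linarith
    · constructor
      · have : t ^ 2 ≤ a⁻¹ * (t ^ 2 * t) := by
          rw [← div_eq_inv_mul, le_div_iff₀ ha]; gcongr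
        nlinarith
      · have : t ≤ (a ^ 2)⁻¹ * (t ^ 2 * t) := by
          rw [← div_eq_inv_mul, le_div_iff₀ (by positivity)]
          nlinarith [mul_le_mul hta hta ha.le ht]
        linarith
  have e : ∀ x, s x = √(s x) ^ 2 := fun x => (Real.sq_sqrt (hs0 x)).symm
  constructor
  · calc ∫ x in ann 1, s x ≤ ∫ x in ann 1, (a⁻¹ * (s x * √(s x)) + a ^ 2) := by
          refine integral_mono (hs.integrableOn_ann 1) ((i0.const_mul _).add (ic _)) fun x => ?_
          have := (key _ (Real.sqrt_nonneg (s x))).1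
          rwa [← e] at this
      _ = a⁻¹ * (∫ x in ann 1, s x * √(s x)) + volume.real (ann 1) * a ^ 2 := by
          rw [integral_add (i0.const_mul _) (ic _), integral_const_mul]
          simp
      _ ≤ a⁻¹ * a ^ 3 + volume.real (ann 1) * a ^ 2 := by gcongr
      _ = _ := by field_simp
  · calc ∫ x in ann 1, √(s x) ≤ ∫ x in ann 1, ((a ^ 2)⁻¹ * (s x * √(s x)) + a) := by
          refine integral_mono (hs.sqrt.integrableOn_ann 1) ((i0.const_mul _).add (ic _))
            fun x => ?_
          have := (key _ (Real.sqrt_nonneg (s x))).2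
          rwa [← e] at this
      _ = (a ^ 2)⁻¹ * (∫ x in ann 1, s x * √(s x)) + volume.real (ann 1) * a := by
          rw [integral_add (i0.const_mul _) (ic _), integral_const_mul]
          simp
      _ ≤ (a ^ 2)⁻¹ * a ^ 3 + volume.real (ann 1) * a := by gcongr
      _ = _ := by field_simp

lemma integral_mul_av {k g q : E3 → ℝ} (hk : IsTest k) (hke : ∀ y, k (-y) = k y)
    (hg : IsTest g) (hq : IsTest q) :
    ∫ x, q x * av k 1 g x = ∫ x, av k 1 q x * g x := by
  obtain ⟨M, -, hM⟩ := hq.exists_bound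
  have hp := integrable_prod_wavg hk.integrable (measurable_smul_E3 1) hg.continuous hg.integrable
  have hp2 : Integrable (fun r : E3 × E3 => q r.1 * (k r.2 • g (r.1 + (1 : ℝ) • r.2)))
      (volume.prod volume) := hp.bdd_mul (c := M)
    (hq.continuous.comp continuous_fst).aestronglyMeasurable
    (Eventually.of_forall fun r => hM _)
  have hp' := integrable_prod_wavg hk.integrable (measurable_smul_E3 (-1)) hq.continuous
    hq.integrable
  obtain ⟨M', -, hM'⟩ := hg.exists_bound
  have hp2' : Integrable (fun r : E3 × E3 => (k r.2 • q (r.1 + (-1 : ℝ) • r.2)) * g r.1)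
      (volume.prod volume) := hp'.mul_bdd (c := M')
    (hg.continuous.comp continuous_fst).aestronglyMeasurable
    (Eventually.of_forall fun r => hM' _)
  have e1 : ∀ x, av k 1 q x = av k (-1) q x := fun x => by
    unfold av wavg
    rw [← integral_neg_eq_self]
    congr 1
    funext y
    simp [hke]
  calc ∫ x, q x * av k 1 g x = ∫ x, ∫ y, q x * (k y • g (x + (1 : ℝ) • y)) := by
        congr 1; funext x
        exact (integral_const_mul _ _).symm
    _ = ∫ y, ∫ x, q x * (k y • g (x + (1 : ℝ) • y)) := integral_integral_swap hp2
    _ = ∫ y, ∫ x, (k y • q (x + (-1 : ℝ) • y)) * g x := by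
        congr 1; funext y
        refine Eq.trans ?_ (integral_add_right_eq_self
          (fun x => (k y • q (x + (-1 : ℝ) • y)) * g x) y)
        congr 1; funext x
        simp
        ring
    _ = ∫ x, ∫ y, (k y • q (x + (-1 : ℝ) • y)) * g x := (integral_integral_swap hp2').symm
    _ = ∫ x, av k 1 q x * g x := by
        congr 1; funext x
        rw [e1]
        exact integral_mul_const _ _

lemma IsNS.abs_pd_av_le {k : E3 → ℝ} (hk : IsTest k) (hk0 : ∀ y, 1 / 20 ≤ ‖y‖ → k y = 0)
    {Θ : E3 → ℝ} (hΘ : IsTest Θ) (hΘ1 : ∀ x, ‖x‖ ≤ 1 → Θ x = 1) {C : ℝ}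
    (hC1 : ∀ x, |slap k x| ≤ C) (hC2 : ∀ j x, |pd j k x| ≤ C) {u : Fin 3 → E3 → ℝ} {p : E3 → ℝ}
    (h : IsNS u p) (m : Fin 3) {x : E3} (hx : 3 / 5 ≤ ‖x‖) (hx' : ‖x‖ ≤ 9 / 10) :
    |pd m (av k 1 fun y => Θ y * p y) x| ≤
      C * (∫ x in ann 1, √(lenSq u x)) + 3 * (C * ∫ x in ann 1, lenSq u x) := by
  have hq : IsTest fun y => Θ y * p y := hΘ.mul_right h.smooth_p
  have hkx := hk.comp_sub x
  have cu : Continuous (lenSq u) := continuous_lenSq fun i => (h.smooth i).continuous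
  have hC0 : 0 ≤ C := (abs_nonneg _).trans (hC1 0)
  have hopen : IsOpen (closedBall (0 : E3) (1 / 20))ᶜ := isClosed_closedBall.isOpen_compl
  have hkz : ∀ y ∈ (closedBall (0 : E3) (1 / 20))ᶜ, k y = 0 := fun y hy => hk0 y (by
    simp at hy; linarith)
  have hfar : ∀ y : E3, y ∉ ann 1 → y - x ∈ (closedBall (0 : E3) (1 / 20))ᶜ := fun y hy => by
    simp only [Set.mem_compl_iff, mem_closedBall, dist_zero_right, not_le]
    by_contra! hc
    refine hy (mem_ann.2 ⟨?_, ?_⟩)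
    · have := norm_le_norm_add_norm_sub' y x
      linarith
    · have := norm_le_norm_add_norm_sub y x
      linarith
  have e : pd m (av k 1 fun y => Θ y * p y) x =
      (∫ y, u m y * slap (fun y => k (y - x)) y) +
      ∑ j, ∫ y, u m y * u j y * pd j (fun y => k (y - x)) y := by
    have e1 : av k 1 (pd m fun y => Θ y * p y) x =
        ∫ y, pd m (fun y => Θ y * p y) y * k (y - x) := by
      rw [← integral_add_left_eq_self _ x]
      unfold av wavg
      congr 1; funext y
      simp [mul_comm]
    have e2 : ∫ y, (Θ y * p y) * pd m (fun y => k (y - x)) y =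
        ∫ y, p y * pd m (fun y => k (y - x)) y := by
      congr 1; funext y
      by_cases hy : y ∈ ann 1
      · rw [hΘ1 y (mem_ann.1 hy).1.le, one_mul]
      · rw [pd_comp_sub]
        simp only [pd_eq_zero_of_isOpen hopen hkz m _ (hfar y hy), mul_zero]
    rw [pd_av hk.integrable hq, e1, integral_pd_mul hq.smooth hkx, e2,
      h.integral_pressure_pd hkx]
    ring
  have b1 : |∫ y, u m y * slap (fun y => k (y - x)) y| ≤ C * ∫ x in ann 1, √(lenSq u x) := by
    rw [slap_comp_sub]
    refine abs_integral_le_of_ann cu.sqrt (fun y hy => ?_) fun y _ => ?_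
    · simp only [slap_eq_zero_of_isOpen hopen hkz _ (hfar y hy), mul_zero]
    · rw [abs_mul, mul_comm]
      exact mul_le_mul (hC1 _) (abs_le_sqrt_lenSq u m y) (abs_nonneg _) hC0
  have b2 : ∀ j, |∫ y, u m y * u j y * pd j (fun y => k (y - x)) y| ≤
      C * ∫ x in ann 1, lenSq u x := fun j => by
    rw [pd_comp_sub]
    refine abs_integral_le_of_ann cu (fun y hy => ?_) fun y _ => ?_
    · simp only [pd_eq_zero_of_isOpen hopen hkz j _ (hfar y hy), mul_zero]
    · rw [abs_mul, mul_comm]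
      exact mul_le_mul (hC2 _ _) (abs_mul_le_lenSq u m j y) (abs_nonneg _) hC0
  rw [e]
  refine (abs_add_le _ _).trans (add_le_add b1 ?_)
  refine (Finset.abs_sum_le_sum_abs _ _).trans ((Finset.sum_le_sum fun j _ => b2 j).trans ?_)
  simp

lemma norm_sub_le_of_inner_nonneg {P : E3 → ℝ} (hP : ContDiff ℝ ∞ P) {L : ℝ}
    (hL : ∀ m, ∀ x : E3, 3 / 5 ≤ ‖x‖ → ‖x‖ ≤ 9 / 10 → |pd m P x| ≤ L) {x y : E3}
    (hx : 17 / 20 ≤ ‖x‖) (hx' : ‖x‖ ≤ 9 / 10) (hy : 17 / 20 ≤ ‖y‖) (hy' : ‖y‖ ≤ 9 / 10)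
    (hxy : 0 ≤ inner ℝ x y) : |P y - P x| ≤ 6 * L := by
  have hL0 : 0 ≤ L := (abs_nonneg _).trans (hL 0 x (by linarith) hx')
  have hf : ∀ z ∈ segment ℝ x y, ‖fderiv ℝ P z‖ ≤ 3 * L := by
    rintro z ⟨a, b, ha, hb, hab, rfl⟩
    have h1 : ‖a • x + b • y‖ ≤ 9 / 10 := by
      refine (norm_add_le _ _).trans ?_
      rw [norm_smul, norm_smul, Real.norm_of_nonneg ha, Real.norm_of_nonneg hb]
      nlinarith
    have h2 : 3 / 5 ≤ ‖a • x + b • y‖ := by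
      refine le_of_sq_le_sq ?_ (norm_nonneg _)
      rw [@norm_add_sq_real, norm_smul, norm_smul, Real.norm_of_nonneg ha,
        Real.norm_of_nonneg hb, real_inner_smul_left, real_inner_smul_right]
      have h3 : (17 / 20 : ℝ) ^ 2 ≤ ‖x‖ ^ 2 := by gcongr
      have h4 : (17 / 20 : ℝ) ^ 2 ≤ ‖y‖ ^ 2 := by gcongr
      have h5 : 0 ≤ a * (b * inner ℝ x y) := by positivity
      have h6 : 1 / 2 ≤ a ^ 2 + b ^ 2 := by nlinarith [sq_nonneg (a - b)]
      nlinarith [mul_le_mul_of_nonneg_left h3 (sq_nonneg a),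
        mul_le_mul_of_nonneg_left h4 (sq_nonneg b)]
    refine ContinuousLinearMap.opNorm_le_bound _ (by positivity) fun v => ?_
    rw [fderiv_apply_eq_sum]
    calc ‖∑ m, v m * pd m P (a • x + b • y)‖ ≤ ∑ m : Fin 3, ‖v‖ * L := by
          refine norm_sum_le_of_le _ fun m _ => ?_
          rw [norm_mul]
          exact mul_le_mul (PiLp.norm_apply_le v m) (hL m _ h2 h1) (norm_nonneg _)
            (norm_nonneg _)
      _ = 3 * L * ‖v‖ := by simp; ring
  have h := (convex_segment x y).norm_image_sub_le_of_norm_fderiv_le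
    (fun z _ => hP.diff_top z) hf (left_mem_segment ℝ x y) (right_mem_segment ℝ x y)
  rw [Real.norm_eq_abs] at h
  refine h.trans ?_
  have : ‖y - x‖ ≤ 2 := (norm_sub_le _ _).trans (by linarith)
  nlinarith

lemma oscillation_le {P : E3 → ℝ} (hP : ContDiff ℝ ∞ P) {L : ℝ}
    (hL : ∀ m, ∀ x : E3, 3 / 5 ≤ ‖x‖ → ‖x‖ ≤ 9 / 10 → |pd m P x| ≤ L) {x : E3}
    (hx : 17 / 20 ≤ ‖x‖) (hx' : ‖x‖ ≤ 9 / 10) :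
    |P x - P (EuclideanSpace.single 1 (9 / 10))| ≤ 12 * L := by
  have key : ∀ t : ℝ, |t| = 9 / 10 → 0 ≤ t * x 0 →
      |P x - P (EuclideanSpace.single 1 (9 / 10))| ≤ 12 * L := fun t ht h0 => by
    have n0 : ‖(EuclideanSpace.single 0 t : E3)‖ = 9 / 10 := by simpa using ht
    have n1 : ‖(EuclideanSpace.single 1 (9 / 10) : E3)‖ = 9 / 10 := by simp
    have h1 := norm_sub_le_of_inner_nonneg hP hL (x := EuclideanSpace.single 0 t) (y := x)
      (by linarith) (by linarith) hx hx' (by simpa [EuclideanSpace.inner_single_left] using h0)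
    have h2 := norm_sub_le_of_inner_nonneg hP hL (x := EuclideanSpace.single 1 (9 / 10))
      (y := EuclideanSpace.single 0 t)
      (by linarith) (by linarith) (by linarith) (by linarith)
      (by simp [EuclideanSpace.inner_single_left])
    calc _ = |(P x - P (EuclideanSpace.single 0 t)) + (P (EuclideanSpace.single 0 t) -
          P (EuclideanSpace.single 1 (9 / 10)))| := by ring_nf
      _ ≤ _ := (abs_add_le _ _).trans (by linarith)
  rcases le_total 0 (x 0) with h | h
  · exact key (9 / 10) (by norm_num) (by positivity)
  · exact key (-(9 / 10)) (by norm_num) (by linarith)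

lemma exists_cutoff {r R : ℝ} (hr : 0 < r) (hR : r < R) :
    ∃ b : E3 → ℝ, IsTest b ∧ (∀ x, 0 ≤ b x) ∧ (∀ x, b x ≤ 1) ∧ (∀ x, ‖x‖ ≤ r → b x = 1) ∧
      ∀ x, R ≤ ‖x‖ → b x = 0 := by
  let b : ContDiffBump (0 : E3) := ⟨r, R, hr, hR⟩
  exact ⟨b, ⟨b.contDiff, b.hasCompactSupport⟩, fun _ => b.nonneg, fun _ => b.le_one,
    fun x hx => b.one_of_mem_closedBall (by simpa using hx),
    fun x hx => b.zero_of_le_dist (by simpa using hx)⟩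

lemma exists_annular_cutoff :
    ∃ χ : E3 → ℝ, IsTest χ ∧ (∀ x, 0 ≤ χ x) ∧ (∀ x, χ x ≤ 1) ∧
      (∀ x, 4 / 5 ≤ ‖x‖ → ‖x‖ ≤ 19 / 20 → χ x = 1) ∧ ∀ x, x ∉ ann 1 → χ x = 0 := by
  obtain ⟨b, hb, b0, b1, b2, b3⟩ := exists_cutoff (r := 19 / 20) (R := 99 / 100) (by norm_num)
    (by norm_num)
  obtain ⟨d, hd, d0, d1, d2, d3⟩ := exists_cutoff (r := 11 / 20) (R := 4 / 5) (by norm_num)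
    (by norm_num)
  refine ⟨fun x => b x * (1 - d x), hb.mul_right (contDiff_const.sub hd.smooth),
    fun x => mul_nonneg (b0 x) (by linarith [d1 x]), fun x => ?_, fun x h1 h2 => ?_,
    fun x hx => ?_⟩
  · exact mul_le_one₀ (b1 x) (by linarith [d1 x]) (by linarith [d0 x])
  · simp [b2 x h2, d3 x h1]
  · rw [mem_ann, not_and_or, not_lt, not_le] at hx
    rcases hx with hx | hx
    · simp [b3 x (by linarith)]
    · simp [d2 x (by linarith)]

/-- A cutoff that is one on the ball of radius `17/20` and vanishes outside the ball of radius
`9/10`. -/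
structure IsCutoff (φ : E3 → ℝ) (C : ℝ) : Prop where
  isTest : IsTest φ
  nonneg : ∀ x, 0 ≤ φ x
  one : ∀ x, ‖x‖ ≤ 17 / 20 → φ x = 1
  zero : ∀ x, 9 / 10 ≤ ‖x‖ → φ x = 0
  pd_le : ∀ i x, |pd i φ x| ≤ C
  slap_le : ∀ x, |slap φ x| ≤ C

namespace IsCutoff

variable {φ : E3 → ℝ} {C : ℝ} {u : Fin 3 → E3 → ℝ}

lemma pd_eq_zero (h : IsCutoff φ C) {x : E3} (hx : ‖x‖ < 17 / 20 ∨ 9 / 10 < ‖x‖) (i : Fin 3) :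
    pd i φ x = 0 := by
  rcases hx with hx | hx
  · exact pd_eq_zero_of_isOpen (isOpen_lt continuous_norm continuous_const)
      (fun y (hy : ‖y‖ < 17 / 20) => h.one y hy.le) i x hx
  · exact pd_eq_zero_of_isOpen (isOpen_lt continuous_const continuous_norm)
      (fun y (hy : 9 / 10 < ‖y‖) => h.zero y hy.le) i x hx

lemma slap_eq_zero (h : IsCutoff φ C) {x : E3} (hx : x ∉ ann 1) : slap φ x = 0 := by
  rw [mem_ann, not_and_or, not_lt, not_le] at hx
  rcases hx with hx | hx
  · exact slap_eq_zero_of_isOpen (isOpen_lt continuous_const continuous_norm)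
      (fun y (hy : 9 / 10 < ‖y‖) => h.zero y hy.le) x (show 9 / 10 < ‖x‖ by linarith)
  · exact slap_eq_zero_of_isOpen (isOpen_lt continuous_norm continuous_const)
      (fun y (hy : ‖y‖ < 17 / 20) => h.one y hy.le) x (show ‖x‖ < 17 / 20 by linarith)

lemma flux_eq_zero (h : IsCutoff φ C) {x : E3} (hx : ‖x‖ < 17 / 20 ∨ 9 / 10 < ‖x‖) :
    IsNS.flux u φ x = 0 :=
  Finset.sum_eq_zero fun i _ => by rw [h.pd_eq_zero hx, mul_zero]

lemma flux_eq_zero_of_notMem (h : IsCutoff φ C) {x : E3} (hx : x ∉ ann 1) :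
    IsNS.flux u φ x = 0 := by
  rw [mem_ann, not_and_or, not_lt, not_le] at hx
  exact h.flux_eq_zero (hx.elim (fun h => .inr (by linarith)) fun h => .inl (by linarith))

lemma abs_flux_le (h : IsCutoff φ C) (x : E3) :
    |IsNS.flux u φ x| ≤ 3 * C * √(lenSq u x) := by
  refine (Finset.abs_sum_le_sum_abs _ _).trans ?_
  have : ∀ i ∈ Finset.univ, |u i x * pd i φ x| ≤ C * √(lenSq u x) := fun i _ => by
    rw [abs_mul, mul_comm]
    exact mul_le_mul (h.pd_le i x) (abs_le_sqrt_lenSq u i x) (abs_nonneg _)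
      ((abs_nonneg _).trans (h.pd_le i x))
  refine (Finset.sum_le_sum this).trans ?_
  simp
  linarith

lemma integral_abs_flux_le (h : IsCutoff φ C) (hu : ∀ i, Continuous (u i)) :
    ∫ x, |IsNS.flux u φ x| ≤ 3 * C * ∫ x in ann 1, √(lenSq u x) :=
  (le_abs_self _).trans <| abs_integral_le_of_ann (continuous_lenSq hu).sqrt
    (fun x hx => by rw [h.flux_eq_zero_of_notMem hx, abs_zero])
    fun x _ => by rw [abs_abs]; exact h.abs_flux_le x

lemma integral_abs_flux_cube_le (h : IsCutoff φ C) (hu : ∀ i, Continuous (u i)) :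
    ∫ x, |IsNS.flux u φ x| ^ 3 ≤ (3 * C) ^ 3 * ∫ x in ann 1, lenSq u x * √(lenSq u x) := by
  have cu := continuous_lenSq hu
  refine (le_abs_self _).trans <| abs_integral_le_of_ann
      (v := fun x => lenSq u x * √(lenSq u x)) (cu.mul cu.sqrt)
    (fun x hx => by rw [h.flux_eq_zero_of_notMem hx]; simp) fun x _ => ?_
  rw [abs_of_nonneg (by positivity)]
  calc |IsNS.flux u φ x| ^ 3 ≤ (3 * C * √(lenSq u x)) ^ 3 :=
        pow_le_pow_left₀ (abs_nonneg _) (h.abs_flux_le x) 3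
    _ = _ := by
        rw [mul_pow, pow_succ (√(lenSq u x)) 2, Real.sq_sqrt (lenSq_nonneg u x)]

lemma integral_lenSq_mul_le (h : IsCutoff φ C) (hu : ∀ i, Continuous (u i)) :
    |∫ x, lenSq u x * slap φ x| ≤ C * ∫ x in ann 1, lenSq u x :=
  abs_integral_le_of_ann (continuous_lenSq hu)
    (fun x hx => by rw [h.slap_eq_zero hx, mul_zero]) fun x _ => by
      rw [abs_mul, abs_of_nonneg (lenSq_nonneg u x), mul_comm]
      exact mul_le_mul_of_nonneg_right (h.slap_le x) (lenSq_nonneg u x)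

lemma integral_lenSq_mul_flux_le (h : IsCutoff φ C) (hu : ∀ i, Continuous (u i)) :
    |∫ x, lenSq u x * IsNS.flux u φ x| ≤
      3 * C * ∫ x in ann 1, lenSq u x * √(lenSq u x) := by
  have cu := continuous_lenSq hu
  refine abs_integral_le_of_ann
      (v := fun x => lenSq u x * √(lenSq u x)) (cu.mul cu.sqrt)
    (fun x hx => by rw [h.flux_eq_zero_of_notMem hx, mul_zero]) fun x _ => ?_
  rw [abs_mul, abs_of_nonneg (lenSq_nonneg u x)]
  calc _ ≤ lenSq u x * (3 * C * √(lenSq u x)) :=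
        mul_le_mul_of_nonneg_left (h.abs_flux_le x) (lenSq_nonneg u x)
    _ = _ := by ring

end IsCutoff

/-- A smooth averaging kernel at scale `1/20`, with bounds on its size. -/
structure IsAveraging (k κ : E3 → ℝ) (C : ℝ) : Prop where
  pair : KernelPair k κ
  isTest : IsTest k
  zero : ∀ y, 1 / 20 ≤ ‖y‖ → k y = 0
  zero' : ∀ y, 1 / 20 ≤ ‖y‖ → κ y = 0
  integral : ∫ y, k y = 1
  even : ∀ y, k (-y) = k y
  abs_le : ∀ x, |k x| ≤ C
  pd_le : ∀ i x, |pd i k x| ≤ C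
  slap_le : ∀ x, |slap k x| ≤ C

namespace IsAveraging

variable {k κ g φ : E3 → ℝ} {C : ℝ}

lemma abs_av_le (h : IsAveraging k κ C) (hg : IsTest g) (x : E3) :
    |av k 1 g x| ≤ C * ∫ y, |g y| := by
  have e : ∫ y, |g (x + (1 : ℝ) • y)| = ∫ y, |g y| := by
    simp only [one_smul]
    exact integral_add_left_eq_self (fun y => |g y|) x
  rw [← e, ← integral_const_mul, ← Real.norm_eq_abs]
  refine norm_integral_le_of_norm_le (Integrable.const_mul ?_ C) (Eventually.of_forall fun y => ?_)
  · simpa using (hg.integrable.abs.comp_add_left x)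
  · rw [norm_smul]
    exact mul_le_mul_of_nonneg_right (h.abs_le y) (norm_nonneg _)

lemma av_eq_zero (h : IsAveraging k κ C) (hg : ∀ x, 9 / 10 < ‖x‖ → g x = 0) {x : E3}
    (hx : 19 / 20 < ‖x‖) : av k 1 g x = 0 := by
  refine integral_eq_zero_of_ae (Eventually.of_forall fun y => ?_)
  rcases le_or_gt (1 / 20) ‖y‖ with hy | hy
  · simp [h.zero y hy]
  · have : 9 / 10 < ‖x + (1 : ℝ) • y‖ := by
      have := norm_sub_le (x + y) y
      simp only [add_sub_cancel_right] at this
      rw [one_smul]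
      linarith
    simp only [hg _ this, smul_zero, Pi.zero_apply]

end IsAveraging

lemma IsNS.abs_integral_mul_hessian_le {u : Fin 3 → E3 → ℝ} {p : E3 → ℝ} (h : IsNS u p)
    {χ f : E3 → ℝ} (hχ : IsTest χ) (χ0 : ∀ x, 0 ≤ χ x) (χ1 : ∀ x, χ x ≤ 1)
    (hχ1 : ∀ x, 4 / 5 ≤ ‖x‖ → ‖x‖ ≤ 19 / 20 → χ x = 1) (hχ0 : ∀ x, x ∉ ann 1 → χ x = 0)
    (hf : IsTest f) (hf0 : ∀ x, ‖x‖ < 4 / 5 ∨ 19 / 20 < ‖x‖ → f x = 0) (i j : Fin 3) :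
    |∫ x, u i x * u j x * pd j (pd i f) x| ≤
      12 * (∫ x, |slap f x| ^ 3) + 30 * ∫ x in ann 1, lenSq u x * √(lenSq u x) := by
  have cu := continuous_lenSq fun i => (h.smooth i).continuous
  have su : ContDiff ℝ ∞ (lenSq u) := ContDiff.sum fun i _ => (h.smooth i).pow 2
  have e : ∀ x, u i x * u j x * pd j (pd i f) x = (χ x * (u i x * u j x)) * pd j (pd i f) x :=
    fun x => by
      by_cases hx : ‖x‖ < 4 / 5 ∨ 19 / 20 < ‖x‖
      · have : pd j (pd i f) x = 0 := by
          rcases hx with hx | hx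
          · have ho : IsOpen {x : E3 | ‖x‖ < 4 / 5} := isOpen_lt continuous_norm continuous_const
            exact pd_eq_zero_of_isOpen ho
              (pd_eq_zero_of_isOpen ho (fun y hy => hf0 y (.inl hy)) i) j x hx
          · have ho : IsOpen {x : E3 | 19 / 20 < ‖x‖} :=
              isOpen_lt continuous_const continuous_norm
            exact pd_eq_zero_of_isOpen ho
              (pd_eq_zero_of_isOpen ho (fun y hy => hf0 y (.inr hy)) i) j x hx
        rw [this, mul_zero, mul_zero]
      · push Not at hx
        rw [hχ1 x hx.1 hx.2, one_mul]
  have hM : ∫ x, (χ x * lenSq u x) * √(χ x * lenSq u x) ≤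
      1 * ∫ x in ann 1, lenSq u x * √(lenSq u x) := by
    refine (le_abs_self _).trans <| abs_integral_le_of_ann
      (v := fun x => lenSq u x * √(lenSq u x)) (cu.mul cu.sqrt)
      (fun x hx => by simp [hχ0 x hx]) fun x _ => ?_
    have h0 := lenSq_nonneg u x
    have h1 : χ x * lenSq u x ≤ lenSq u x := mul_le_of_le_one_left h0 (χ1 x)
    have h2 := mul_nonneg (χ0 x) h0
    rw [abs_of_nonneg (by positivity), one_mul]
    exact mul_le_mul h1 (Real.sqrt_le_sqrt h1) (Real.sqrt_nonneg _) h0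
  simp only [e]
  have := _root_.abs_integral_mul_hessian_le hf
    (hχ.mul_right ((h.smooth i).mul (h.smooth j))) (hχ.mul_right su)
    (fun x => by
      rw [abs_mul, abs_of_nonneg (χ0 x)]
      exact mul_le_mul_of_nonneg_left (abs_mul_le_lenSq u i j x) (χ0 x)) j i
  linarith

lemma IsAveraging.contDiff_av {k κ g : E3 → ℝ} {C : ℝ} (h : IsAveraging k κ C) (hg : IsTest g) :
    ContDiff ℝ ∞ (av k 1 g) :=
  contDiff_wavg h.isTest.integrable (measurable_smul_E3 1) hg

namespace IsNS

variable {u : Fin 3 → E3 → ℝ} {p k κ φ Θ χ : E3 → ℝ} {C : ℝ}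

lemma abs_integral_pressure_av_le (h : IsNS u p) (hk : IsAveraging k κ C) (hφ : IsCutoff φ C)
    (hΘ : IsTest Θ) (hΘ1 : ∀ x, ‖x‖ ≤ 1 → Θ x = 1) :
    |∫ x, p x * av k 1 (flux u φ) x| ≤
      12 * (C * (∫ x in ann 1, √(lenSq u x)) + 3 * (C * ∫ x in ann 1, lenSq u x)) *
        (3 * C * ∫ x in ann 1, √(lenSq u x)) := by
  have hg := h.isTest_flux hφ.isTest
  have hq : IsTest fun y => Θ y * p y := hΘ.mul_right h.smooth_p
  set P := av k 1 fun y => Θ y * p y with hP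
  have sP : ContDiff ℝ ∞ P := hk.contDiff_av hq
  set c := P (EuclideanSpace.single 1 (9 / 10)) with hc
  set L := C * (∫ x in ann 1, √(lenSq u x)) + 3 * (C * ∫ x in ann 1, lenSq u x) with hL
  have hL1 : ∀ m, ∀ x : E3, 3 / 5 ≤ ‖x‖ → ‖x‖ ≤ 9 / 10 → |pd m P x| ≤ L := fun m x h1 h2 =>
    h.abs_pd_av_le hk.isTest hk.zero hΘ hΘ1 (fun x => hk.slap_le x)
      (fun j x => hk.pd_le j x) m h1 h2
  have e : ∫ x, p x * av k 1 (flux u φ) x = ∫ x, (P x - c) * flux u φ x := by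
    have e1 : ∀ x, p x * av k 1 (flux u φ) x = (Θ x * p x) * av k 1 (flux u φ) x := fun x => by
      rcases le_or_gt ‖x‖ 1 with hx | hx
      · rw [hΘ1 x hx, one_mul]
      · rw [hk.av_eq_zero (fun y hy => hφ.flux_eq_zero (.inr hy)) (by linarith), mul_zero,
          mul_zero]
    simp only [e1, sub_mul]
    rw [integral_mul_av hk.isTest hk.even hg hq, integral_sub (hg.mul_left sP).integrable
      (hg.integrable.const_mul c), integral_const_mul, h.integral_flux hφ.isTest, mul_zero,
      sub_zero]
  have hL0 : 0 ≤ L := (abs_nonneg _).trans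
    (hL1 0 (EuclideanSpace.single 1 (9 / 10)) (by simp; norm_num) (by simp))
  calc |∫ x, p x * av k 1 (flux u φ) x| ≤ ∫ x, 12 * L * |flux u φ x| := by
        rw [e, ← Real.norm_eq_abs]
        refine norm_integral_le_of_norm_le (hg.integrable.abs.const_mul _)
          (Eventually.of_forall fun x => ?_)
        rw [norm_mul, Real.norm_eq_abs, Real.norm_eq_abs]
        by_cases hx : ‖x‖ < 17 / 20 ∨ 9 / 10 < ‖x‖
        · rw [hφ.flux_eq_zero hx, abs_zero, mul_zero, mul_zero]
        · push Not at hx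
          exact mul_le_mul_of_nonneg_right (oscillation_le sP hL1 hx.1 hx.2) (abs_nonneg _)
    _ ≤ _ := by
        rw [integral_const_mul]
        exact mul_le_mul_of_nonneg_left
          (hφ.integral_abs_flux_le fun i => (h.smooth i).continuous) (by positivity)

lemma exists_pressure_potential (h : IsNS u p) (hk : IsAveraging k κ C) (hφ : IsCutoff φ C) :
    ∃ f, IsTest f ∧ (∀ x, slap f x = flux u φ x - av k 1 (flux u φ) x) ∧
      (∀ x, ‖x‖ < 4 / 5 ∨ 19 / 20 < ‖x‖ → f x = 0) ∧
      ∫ x, |slap f x| ^ 3 ≤ 4 * ((3 * C) ^ 3 * ∫ x in ann 1, lenSq u x * √(lenSq u x)) +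
        4 * (C * (3 * C * ∫ x in ann 1, √(lenSq u x))) ^ 3 *
          volume.real (closedBall (0 : E3) 1) := by
  have hu : ∀ i, Continuous (u i) := fun i => (h.smooth i).continuous
  have hg := h.isTest_flux hφ.isTest
  obtain ⟨f, hf, hf1, hf2⟩ := exists_local_inverse_laplacian hk.pair hk.integral hk.zero' hg
  have hC : 0 ≤ C := (abs_nonneg _).trans (hk.abs_le 0)
  set B := C * (3 * C * ∫ x in ann 1, √(lenSq u x)) with hB
  have hav : ∀ x, |av k 1 (flux u φ) x| ≤ B := fun x =>
    (hk.abs_av_le hg x).trans (mul_le_mul_of_nonneg_left (hφ.integral_abs_flux_le hu) hC)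
  have hB0 : 0 ≤ B := (abs_nonneg _).trans (hav 0)
  refine ⟨f, hf, hf1, fun x hx => hf2 x fun y hy => hφ.flux_eq_zero ?_, ?_⟩
  · refine hx.imp (fun hx => ?_) fun hx => ?_
    · linarith [norm_add_le x y]
    · have := norm_sub_le (x + y) y
      simp only [add_sub_cancel_right] at this
      linarith
  · have i3 : Integrable fun x => |flux u φ x| ^ 3 := hg.integrable_abs_cube
    have hz : ∀ x, x ∉ closedBall (0 : E3) 1 → |slap f x| ^ 3 = 0 := fun x hx => by
      rw [mem_closedBall, dist_zero_right, not_le] at hx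
      rw [hf1, hφ.flux_eq_zero (.inr (by linarith)),
        hk.av_eq_zero (fun y hy => hφ.flux_eq_zero (.inr hy)) (by linarith)]
      simp
    rw [← setIntegral_eq_integral_of_forall_compl_eq_zero hz]
    have ic : IntegrableOn (fun _ : E3 => 4 * B ^ 3) (closedBall 0 1) :=
      integrableOn_const (isCompact_closedBall _ _).measure_lt_top.ne
    calc ∫ x in closedBall 0 1, |slap f x| ^ 3
        ≤ ∫ x in closedBall 0 1, (4 * |flux u φ x| ^ 3 + 4 * B ^ 3) := by
          refine integral_mono hf.slap.integrable_abs_cube.integrableOn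
            ((i3.integrableOn.const_mul 4).add ic) fun x => ?_
          have h1 : |slap f x| ≤ |flux u φ x| + B := by
            rw [hf1]
            exact (abs_sub _ _).trans (by linarith [hav x])
          refine (pow_le_pow_left₀ (abs_nonneg _) h1 3).trans ?_
          have ha := abs_nonneg (flux u φ x)
          generalize |flux u φ x| = t at ha
          show (t + B) ^ 3 ≤ 4 * t ^ 3 + 4 * B ^ 3
          nlinarith [mul_nonneg (add_nonneg ha hB0) (sq_nonneg (t - B))]
      _ = 4 * (∫ x in closedBall 0 1, |flux u φ x| ^ 3) +
            4 * B ^ 3 * volume.real (closedBall (0 : E3) 1) := by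
          rw [integral_add (i3.integrableOn.const_mul 4) ic, integral_const_mul]
          simp [mul_comm]
      _ ≤ _ := by
          gcongr
          exact (setIntegral_le_integral i3 (Eventually.of_forall fun x => by positivity)).trans
            (hφ.integral_abs_flux_cube_le hu)

lemma integral_gradient_le (h : IsNS u p) (hk : IsAveraging k κ C) (hφ : IsCutoff φ C)
    (hΘ : IsTest Θ) (hΘ1 : ∀ x, ‖x‖ ≤ 1 → Θ x = 1)
    (hχ : IsTest χ) (χ0 : ∀ x, 0 ≤ χ x) (χ1 : ∀ x, χ x ≤ 1)
    (hχ1 : ∀ x, 4 / 5 ≤ ‖x‖ → ‖x‖ ≤ 19 / 20 → χ x = 1) (hχ0 : ∀ x, x ∉ ann 1 → χ x = 0)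
    {A B D : ℝ} (hA : ∫ x in ann 1, √(lenSq u x) ≤ A) (hB : ∫ x in ann 1, lenSq u x ≤ B)
    (hD : ∫ x in ann 1, lenSq u x * √(lenSq u x) ≤ D) :
    ∫ x in ball 0 (1 / 2), ∑ i, ∑ j, (pd j (u i) x) ^ 2 ≤
      1 / 2 * (C * B) + 1 / 2 * (3 * C * D) +
        9 * (12 * (4 * ((3 * C) ^ 3 * D) + 4 * (C * (3 * C * A)) ^ 3 *
          volume.real (closedBall (0 : E3) 1)) + 30 * D) +
        12 * (C * A + 3 * (C * B)) * (3 * C * A) := by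
  have hu : ∀ i, Continuous (u i) := fun i => (h.smooth i).continuous
  have hg := h.isTest_flux hφ.isTest
  have hC : 0 ≤ C := (abs_nonneg _).trans (hk.abs_le 0)
  have A0 : 0 ≤ ∫ x in ann 1, √(lenSq u x) := integral_nonneg fun x => Real.sqrt_nonneg _
  have B0 : 0 ≤ ∫ x in ann 1, lenSq u x := integral_nonneg fun x => lenSq_nonneg u x
  have su : ContDiff ℝ ∞ fun x => ∑ i, ∑ j, (pd j (u i) x) ^ 2 :=
    ContDiff.sum fun i _ => ContDiff.sum fun j _ => (contDiff_pd (h.smooth i)).pow 2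
  have s0 : ∀ x, 0 ≤ ∑ i, ∑ j, (pd j (u i) x) ^ 2 := fun x =>
    Finset.sum_nonneg fun i _ => Finset.sum_nonneg fun j _ => sq_nonneg _
  have hi : Integrable fun x => φ x * ∑ i, ∑ j, (pd j (u i) x) ^ 2 :=
    (hφ.isTest.mul_right su).integrable
  have h1 : ∫ x in ball 0 (1 / 2), ∑ i, ∑ j, (pd j (u i) x) ^ 2 ≤
      ∫ x, φ x * ∑ i, ∑ j, (pd j (u i) x) ^ 2 := by
    have e : ∫ x in ball 0 (1 / 2), ∑ i, ∑ j, (pd j (u i) x) ^ 2 =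
        ∫ x in ball 0 (1 / 2), φ x * ∑ i, ∑ j, (pd j (u i) x) ^ 2 := by
      refine setIntegral_congr_fun measurableSet_ball fun x hx => ?_
      rw [mem_ball_zero_iff] at hx
      simp only [hφ.one x (by linarith), one_mul]
    rw [e]
    exact setIntegral_le_integral hi
      (Eventually.of_forall fun x => mul_nonneg (hφ.nonneg x) (s0 x))
  rw [h.energy_identity hφ.isTest] at h1
  obtain ⟨f, hf, hf1, hf2, hf3⟩ := h.exists_pressure_potential hk hφ
  have e2 : ∫ x, p x * av k 1 (flux u φ) x =
      (∫ x, p x * flux u φ x) - ∫ x, p x * slap f x := by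
    rw [← integral_sub (hg.mul_left h.smooth_p).integrable (hf.slap.mul_left h.smooth_p).integrable]
    congr 1
    funext x
    rw [hf1]
    ring
  have t1 := (le_abs_self _).trans (hφ.integral_lenSq_mul_le hu)
  have t2 := (le_abs_self _).trans (hφ.integral_lenSq_mul_flux_le hu)
  have t3 := (le_abs_self _).trans (h.abs_integral_pressure_av_le hk hφ hΘ hΘ1)
  have t4 : ∫ x, p x * slap f x ≤ 9 * (12 * (∫ x, |slap f x| ^ 3) +
      30 * ∫ x in ann 1, lenSq u x * √(lenSq u x)) := by
    rw [h.integral_pressure_slap hf, ← Finset.sum_neg_distrib]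
    simp only [← Finset.sum_neg_distrib]
    have : ∀ i ∈ Finset.univ, ∀ j ∈ Finset.univ, -∫ x, u i x * u j x * pd j (pd i f) x ≤
        12 * (∫ x, |slap f x| ^ 3) + 30 * ∫ x in ann 1, lenSq u x * √(lenSq u x) :=
      fun i _ j _ => (neg_le_abs _).trans
        (h.abs_integral_mul_hessian_le hχ χ0 χ1 hχ1 hχ0 hf hf2 i j)
    refine (Finset.sum_le_sum fun i hi => Finset.sum_le_sum fun j hj => this i hi j hj).trans ?_
    simp
    linarith
  have b1 := mul_le_mul_of_nonneg_left hB hC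
  have b2 := mul_le_mul_of_nonneg_left hD hC
  have b3 := mul_le_mul_of_nonneg_left hD (pow_nonneg (mul_nonneg zero_le_three hC) 3)
  have b4 : 4 * (C * (3 * C * ∫ x in ann 1, √(lenSq u x))) ^ 3 *
      volume.real (closedBall (0 : E3) 1) ≤ 4 * (C * (3 * C * A)) ^ 3 *
      volume.real (closedBall (0 : E3) 1) := by gcongr
  have b5 : 12 * (C * (∫ x in ann 1, √(lenSq u x)) + 3 * (C * ∫ x in ann 1, lenSq u x)) *
        (3 * C * ∫ x in ann 1, √(lenSq u x)) ≤ 12 * (C * A + 3 * (C * B)) * (3 * C * A) := by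
    have := A0.trans hA
    have := B0.trans hB
    gcongr
  unfold lenSq at *
  linarith

end IsNS

lemma exists_coefficient_bound {C V W : ℝ} (hC : 0 ≤ C) (hV : 0 ≤ V) (hW : 0 ≤ W) :
    ∃ K : ℝ, 0 < K ∧ ∀ a : ℝ, 0 ≤ a →
      1 / 2 * (C * (V * a ^ 2)) + 1 / 2 * (3 * C * a ^ 3) +
        9 * (12 * (4 * ((3 * C) ^ 3 * a ^ 3) + 4 * (C * (3 * C * (V * a))) ^ 3 * W) +
          30 * a ^ 3) + 12 * (C * (V * a) + 3 * (C * (V * a ^ 2))) * (3 * C * (V * a)) ≤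
      K * (a ^ 2 + a ^ 3) := by
  obtain ⟨x, hx⟩ : ∃ x, x = 1 / 2 * (C * V) + 12 * (C * V) * (3 * C * V) := ⟨_, rfl⟩
  obtain ⟨y, hy⟩ : ∃ y, y = 1 / 2 * (3 * C) + 9 * (12 * (4 * (3 * C) ^ 3 +
    4 * (C * (3 * C * V)) ^ 3 * W) + 30) + 12 * (3 * (C * V)) * (3 * C * V) := ⟨_, rfl⟩
  have hx0 : 0 ≤ x := by rw [hx]; positivity
  have hy0 : 0 ≤ y := by rw [hy]; positivity
  refine ⟨1 + x + y, by positivity, fun a ha => ?_⟩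
  calc _ = x * a ^ 2 + y * a ^ 3 := by rw [hx, hy]; ring
    _ ≤ _ := by nlinarith [mul_nonneg hx0 (pow_nonneg ha 3), mul_nonneg hy0 (pow_nonneg ha 2),
      pow_nonneg ha 3, pow_nonneg ha 2]

theorem exists_local_energy_bound : ∃ K : ℝ, 0 < K ∧ ∀ (u : Fin 3 → E3 → ℝ) (p : E3 → ℝ),
    IsNS u p → ∀ a : ℝ, 0 < a → ∫ x in ann 1, lenSq u x * √(lenSq u x) ≤ a ^ 3 →
      ∫ x in ball 0 (1 / 2), ∑ i, ∑ j, (pd j (u i) x) ^ 2 ≤ K * (a ^ 2 + a ^ 3) := by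
  obtain ⟨k, κ, hk, tk, -, k0, κ0, k1, ke⟩ := exists_compact_kernel (δ := 1 / 20) (by norm_num)
  obtain ⟨φ, tφ, φ0, -, φ1, φ2⟩ := exists_cutoff (r := 17 / 20) (R := 9 / 10) (by norm_num)
    (by norm_num)
  obtain ⟨Θ, tΘ, -, -, Θ1, -⟩ := exists_cutoff (r := 1) (R := 2) (by norm_num) (by norm_num)
  obtain ⟨χ, tχ, χ0, χ1, χ2, χ3⟩ := exists_annular_cutoff
  obtain ⟨c1, n1, h1⟩ := tk.exists_bound
  obtain ⟨c2, n2, h2⟩ := tk.slap.exists_bound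
  choose c3 n3 h3 using fun i => (tk.pd i).exists_bound
  obtain ⟨c4, n4, h4⟩ := tφ.slap.exists_bound
  choose c5 n5 h5 using fun i => (tφ.pd i).exists_bound
  have p3 : 0 ≤ ∑ i, c3 i := Finset.sum_nonneg fun i _ => n3 i
  have p5 : 0 ≤ ∑ i, c5 i := Finset.sum_nonneg fun i _ => n5 i
  set C := c1 + c2 + (∑ i, c3 i) + c4 + ∑ i, c5 i with hC
  have q3 : ∀ i, c3 i ≤ ∑ i, c3 i := fun i =>
    Finset.single_le_sum (fun i _ => n3 i) (Finset.mem_univ i)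
  have q5 : ∀ i, c5 i ≤ ∑ i, c5 i := fun i =>
    Finset.single_le_sum (fun i _ => n5 i) (Finset.mem_univ i)
  have hav : IsAveraging k κ C := ⟨hk, tk, k0, κ0, k1, ke, fun x => (h1 x).trans (by linarith),
    fun i x => (h3 i x).trans (by linarith [q3 i]), fun x => (h2 x).trans (by linarith)⟩
  have hcut : IsCutoff φ C := ⟨tφ, φ0, φ1, φ2,
    fun i x => (h5 i x).trans (by linarith [q5 i]), fun x => (h4 x).trans (by linarith)⟩
  have C0 : 0 ≤ C := by positivity
  set V := 1 + volume.real (ann 1) with hV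
  have V0 : 0 ≤ V := by positivity
  set W := volume.real (closedBall (0 : E3) 1) with hW
  have W0 : 0 ≤ W := by positivity
  obtain ⟨K, K0, hK⟩ := exists_coefficient_bound C0 V0 W0
  refine ⟨K, K0, fun u p h a ha hA => ?_⟩
  have cu := continuous_lenSq fun i => (h.smooth i).continuous
  obtain ⟨hs1, hs2⟩ := integral_ann_le cu (lenSq_nonneg u) ha hA
  exact (h.integral_gradient_le hav hcut tΘ Θ1 tχ χ0 χ1 χ2 χ3 hs2 hs1 hA).trans (hK a ha.le)

lemma pd_component {u : E3 → E3} (hu : ContDiff ℝ ∞ u) (i j : Fin 3) (x : E3) :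
    pd j (fun y => u y i) x = fderiv ℝ u x (EuclideanSpace.single j 1) i := by
  have h := ((EuclideanSpace.proj (𝕜 := ℝ) i).hasFDerivAt (x := u x)).comp x
    (hu.diff_top x).hasFDerivAt
  have h' : HasFDerivAt (fun y => u y i)
    ((EuclideanSpace.proj (𝕜 := ℝ) i).comp (fderiv ℝ u x)) x := h
  unfold pd
  rw [h'.fderiv]
  rfl

lemma SteadyNS.isNS {u : E3 → E3} {p : E3 → ℝ} (hu : ContDiff ℝ ∞ u) (hp : ContDiff ℝ ∞ p)
    (h : SteadyNS u p) : IsNS (fun i x => u x i) p := by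
  have su : ∀ i, ContDiff ℝ ∞ fun x => u x i := fun i =>
    (EuclideanSpace.proj (𝕜 := ℝ) i).contDiff.comp hu
  refine ⟨su, hp, fun i x => ?_, fun x => ?_⟩
  · have e := congrArg (fun v : E3 => v i) (h.1 x)
    have e1 : lap u x i = slap (fun y => u y i) x := by
      simp only [lap, slap, WithLp.ofLp_sum, Finset.sum_apply]
      refine Finset.sum_congr rfl fun m _ => ?_
      rw [← pd_component (u := fun y => fderiv ℝ u y (EuclideanSpace.single m 1))
        ((hu.fderiv_right (m := ∞) (by simp)).clm_apply contDiff_const)]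
      congr 1
      funext y
      exact (pd_component hu i m y).symm
    have e2 : conv u x i = ∑ j, u x j * pd j (fun y => u y i) x := by
      rw [← fderiv_apply_eq_sum]
      have h' : HasFDerivAt (fun y => u y i)
          ((EuclideanSpace.proj (𝕜 := ℝ) i).comp (fderiv ℝ u x)) x :=
        ((EuclideanSpace.proj (𝕜 := ℝ) i).hasFDerivAt (x := u x)).comp x
          (hu.diff_top x).hasFDerivAt
      rw [h'.fderiv]
      rfl
    have e3 : gradp p x i = pd i p x := by
      simp [gradp, pd, Pi.single_apply]
    simp only [PiLp.add_apply, PiLp.neg_apply, PiLp.zero_apply] at e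
    rw [← e1, ← e2, ← e3]
    exact e
  · have e := h.2 x
    simp only [divg] at e
    simpa only [pd_component hu] using e

lemma pd_const_mul_comp_smul {h : E3 → ℝ} (hh : ContDiff ℝ ∞ h) (c R : ℝ) (i : Fin 3) (x : E3) :
    pd i (fun y => c * h (R • y)) x = c * R * pd i h (R • x) := by
  have h1 : HasFDerivAt (fun y : E3 => R • y) (R • ContinuousLinearMap.id ℝ E3) x :=
    (hasFDerivAt_id x).const_smul R
  have h2 := (((hh.diff_top (R • x)).hasFDerivAt).comp x h1).const_mul c
  have h3 : HasFDerivAt (fun y => c * h (R • y))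
    (c • (fderiv ℝ h (R • x)).comp (R • ContinuousLinearMap.id ℝ E3)) x := h2
  unfold pd
  rw [h3.fderiv]
  simp [mul_assoc]

lemma slap_const_mul_comp_smul {h : E3 → ℝ} (hh : ContDiff ℝ ∞ h) (c R : ℝ) (x : E3) :
    slap (fun y => c * h (R • y)) x = c * R ^ 2 * slap h (R • x) := by
  have e : ∀ m, pd m (fun y => c * h (R • y)) = fun y => (c * R) * pd m h (R • y) := fun m =>
    funext fun y => pd_const_mul_comp_smul hh c R m y
  simp only [slap, e, pd_const_mul_comp_smul (contDiff_pd hh), Finset.mul_sum]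
  exact Finset.sum_congr rfl fun m _ => by ring

lemma IsNS.rescale {u : Fin 3 → E3 → ℝ} {p : E3 → ℝ} (h : IsNS u p) (R : ℝ) :
    IsNS (fun i x => R * u i (R • x)) fun x => R ^ 2 * p (R • x) := by
  have sc : ContDiff ℝ ∞ fun x : E3 => R • x := contDiff_const_smul R
  refine ⟨fun i => contDiff_const.mul ((h.smooth i).comp sc),
    contDiff_const.mul (h.smooth_p.comp sc), fun i x => ?_, fun x => ?_⟩
  · simp only [slap_const_mul_comp_smul (h.smooth _), pd_const_mul_comp_smul (h.smooth _),
      pd_const_mul_comp_smul h.smooth_p]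
    have e := h.eq i (R • x)
    have e2 : ∑ j, R * u j (R • x) * (R * R * pd j (u i) (R • x)) =
        R ^ 3 * ∑ j, u j (R • x) * pd j (u i) (R • x) := by
      rw [Finset.mul_sum]
      exact Finset.sum_congr rfl fun j _ => by ring
    rw [e2]
    linear_combination R ^ 3 * e
  · simp only [pd_const_mul_comp_smul (h.smooth _), ← Finset.mul_sum, h.div, mul_zero]

lemma smul_ann {R : ℝ} (hR : 0 < R) : R • ann 1 = ann R := by
  ext x
  rw [Set.mem_smul_set_iff_inv_smul_mem₀ hR.ne', mem_ann, mem_ann, norm_smul, norm_inv,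
    Real.norm_eq_abs, abs_of_pos hR, inv_mul_lt_iff₀ hR, le_inv_mul_iff₀ hR, mul_one,
    mul_one_div]

theorem exists_energy_bound : ∃ K : ℝ, 0 < K ∧ ∀ (u : Fin 3 → E3 → ℝ) (p : E3 → ℝ),
    IsNS u p → ∀ R a : ℝ, 0 < R → 0 < a → ∫ x in ann R, lenSq u x * √(lenSq u x) ≤ a ^ 3 →
      R * ∫ x in ball 0 (R / 2), ∑ i, ∑ j, (pd j (u i) x) ^ 2 ≤ K * (a ^ 2 + a ^ 3) := by
  obtain ⟨K, K0, hK⟩ := exists_local_energy_bound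
  refine ⟨K, K0, fun u p h R a hR ha hA => ?_⟩
  have hd : Module.finrank ℝ E3 = 3 := by simp
  have e1 : ∀ x, lenSq (fun i x => R * u i (R • x)) x *
      √(lenSq (fun i x => R * u i (R • x)) x) =
      R ^ 3 * (lenSq u (R • x) * √(lenSq u (R • x))) := fun x => by
    have : lenSq (fun i x => R * u i (R • x)) x = R ^ 2 * lenSq u (R • x) := by
      simp only [lenSq, mul_pow, Finset.mul_sum]
    rw [this, Real.sqrt_mul (sq_nonneg R), Real.sqrt_sq hR.le]
    ring
  have e2 : ∀ x, ∑ i, ∑ j, (pd j (fun x => R * u i (R • x)) x) ^ 2 =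
      R ^ 4 * ∑ i, ∑ j, (pd j (u i) (R • x)) ^ 2 := fun x => by
    simp only [pd_const_mul_comp_smul (h.smooth _), Finset.mul_sum]
    exact Finset.sum_congr rfl fun i _ => Finset.sum_congr rfl fun j _ => by ring
  have e3 : R • ball (0 : E3) (1 / 2) = ball 0 (R / 2) := by
    rw [_root_.smul_ball hR.ne', smul_zero, Real.norm_eq_abs, abs_of_pos hR, mul_one_div]
  have key := hK _ _ (h.rescale R) a ha (by
    simp only [e1]
    rw [integral_const_mul, Measure.setIntegral_comp_smul_of_pos volume
      (fun x => lenSq u x * √(lenSq u x)) (ann 1) hR, hd, smul_ann hR, smul_eq_mul,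
      mul_inv_cancel_left₀ (by positivity)]
    exact hA)
  simp only [e2] at key
  rw [integral_const_mul, Measure.setIntegral_comp_smul_of_pos volume
    (fun x => ∑ i, ∑ j, (pd j (u i) x) ^ 2) _ hR, hd, e3, smul_eq_mul] at key
  convert key using 1
  field_simp

lemma norm_fderiv_sq_le {u : E3 → E3} (hu : ContDiff ℝ ∞ u) (x : E3) :
    ‖fderiv ℝ u x‖ ^ 2 ≤ ∑ i, ∑ j, (pd j (fun y => u y i) x) ^ 2 := by
  have s0 : 0 ≤ ∑ i, ∑ j, (pd j (fun y => u y i) x) ^ 2 :=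
    Finset.sum_nonneg fun i _ => Finset.sum_nonneg fun j _ => sq_nonneg _
  refine (Real.le_sqrt (norm_nonneg _) s0).1 ?_
  refine ContinuousLinearMap.opNorm_le_bound _ (Real.sqrt_nonneg _) fun v => ?_
  rw [EuclideanSpace.norm_eq, EuclideanSpace.norm_eq v, ← Real.sqrt_mul s0]
  refine Real.sqrt_le_sqrt ?_
  rw [Finset.sum_mul]
  refine Finset.sum_le_sum fun i _ => ?_
  have e : fderiv ℝ u x v i = ∑ j, pd j (fun y => u y i) x * v j := by
    have h' : HasFDerivAt (fun y => u y i)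
        ((EuclideanSpace.proj (𝕜 := ℝ) i).comp (fderiv ℝ u x)) x :=
      ((EuclideanSpace.proj (𝕜 := ℝ) i).hasFDerivAt (x := u x)).comp x
        (hu.diff_top x).hasFDerivAt
    have := fderiv_apply_eq_sum (fun y => u y i) x v
    rw [h'.fderiv] at this
    simp only [mul_comm (pd _ _ _)]
    exact this
  rw [e]
  simp only [Real.norm_eq_abs, sq_abs]
  exact Finset.sum_mul_sq_le_sq_mul_sq _ _ _

theorem exists_lintegral_energy_bound : ∃ K : ℝ, 0 < K ∧ ∀ (u : E3 → E3) (p : E3 → ℝ),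
    ContDiff ℝ ∞ u → ContDiff ℝ ∞ p → SteadyNS u p → ∀ R a : ℝ, 0 < R → 0 < a →
      ∫⁻ x in ann R, ENNReal.ofReal (‖u x‖ ^ (3 : ℝ)) ≤ ENNReal.ofReal (a ^ 3) →
      ∫⁻ x in ball 0 (R / 2), ENNReal.ofReal (‖fderiv ℝ u x‖ ^ 2) ≤
        ENNReal.ofReal (R⁻¹ * (K * (a ^ 2 + a ^ 3))) := by
  obtain ⟨K, K0, hK⟩ := exists_energy_bound
  refine ⟨K, K0, fun u p hu hp h R a hR ha hA => ?_⟩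
  have hns := h.isNS hu hp
  have e : ∀ x, lenSq (fun i x => u x i) x * √(lenSq (fun i x => u x i) x) = ‖u x‖ ^ 3 :=
    fun x => by
      have : lenSq (fun i x => u x i) x = ‖u x‖ ^ 2 := by
        rw [EuclideanSpace.norm_sq_eq]
        simp [lenSq]
      rw [this, Real.sqrt_sq (norm_nonneg _)]
      ring
  have key := hK _ p hns R a hR ha (by
    simp only [e]
    refine (ENNReal.ofReal_le_ofReal_iff (by positivity)).1 (le_trans (le_of_eq ?_) hA)
    have hi : IntegrableOn (fun x => ‖u x‖ ^ 3) (ann R) :=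
      Continuous.integrableOn_ann (hu.continuous.norm.pow 3) R
    rw [ofReal_integral_eq_lintegral_ofReal hi (Eventually.of_forall fun x => by positivity)]
    refine lintegral_congr fun x => ?_
    norm_cast)
  have sc : Continuous fun x => ∑ i, ∑ j, (pd j (fun y => u y i) x) ^ 2 :=
    continuous_finsetSum _ fun i _ => continuous_finsetSum _ fun j _ =>
      (contDiff_pd (hns.smooth i)).continuous.pow 2
  have hi : IntegrableOn (fun x => ∑ i, ∑ j, (pd j (fun y => u y i) x) ^ 2) (ball 0 (R / 2)) :=
    (sc.continuousOn.integrableOn_compact (isCompact_closedBall (0 : E3) (R / 2))).mono_set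
      ball_subset_closedBall
  calc ∫⁻ x in ball 0 (R / 2), ENNReal.ofReal (‖fderiv ℝ u x‖ ^ 2)
      ≤ ∫⁻ x in ball 0 (R / 2), ENNReal.ofReal (∑ i, ∑ j, (pd j (fun y => u y i) x) ^ 2) :=
        lintegral_mono fun x => ENNReal.ofReal_le_ofReal (norm_fderiv_sq_le hu x)
    _ = ENNReal.ofReal (∫ x in ball 0 (R / 2), ∑ i, ∑ j, (pd j (fun y => u y i) x) ^ 2) :=
        (ofReal_integral_eq_lintegral_ofReal hi (Eventually.of_forall fun x =>
          Finset.sum_nonneg fun i _ => Finset.sum_nonneg fun j _ => sq_nonneg _)).symm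
    _ ≤ _ := ENNReal.ofReal_le_ofReal ((le_inv_mul_iff₀ hR).2 key)

lemma lintegral_Ioc_rpow {r t : ℝ} (hr : -1 < r) (ht : 0 < t) :
    ∫⁻ σ in Set.Ioc 0 t, ENNReal.ofReal (σ ^ r) = ENNReal.ofReal (t ^ (r + 1) / (r + 1)) := by
  have hi : IntegrableOn (fun σ : ℝ => σ ^ r) (Set.Ioc 0 t) :=
    (intervalIntegrable_iff_integrableOn_Ioc_of_le ht.le).1
      (intervalIntegral.intervalIntegrable_rpow' hr)
  rw [← ofReal_integral_eq_lintegral_ofReal hi, ← intervalIntegral.integral_of_le ht.le,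
    integral_rpow (.inl hr), Real.zero_rpow (by linarith), sub_zero]
  filter_upwards [ae_restrict_mem measurableSet_Ioc] with σ hσ using Real.rpow_nonneg hσ.1.le _

lemma lintegral_Ioi_rpow {r t : ℝ} (hr : r < -1) (ht : 0 < t) :
    ∫⁻ σ in Set.Ioi t, ENNReal.ofReal (σ ^ r) = ENNReal.ofReal (-t ^ (r + 1) / (r + 1)) := by
  rw [← ofReal_integral_eq_lintegral_ofReal (integrableOn_Ioi_rpow_of_lt hr ht),
    integral_Ioi_rpow_of_lt hr ht]
  filter_upwards [ae_restrict_mem measurableSet_Ioi] with σ hσ using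
    Real.rpow_nonneg (ht.trans hσ).le _

section Lorentz

variable {α F : Type*} [MeasurableSpace α] [NormedAddCommGroup F] {μ : Measure α} {f : α → F}
  {Ω : Set α}

lemma le_ofReal_rpow_of_rpow_le {x : ℝ≥0∞} {b r : ℝ} (hb : 0 ≤ b) (hr : 0 < r)
    (h : x ^ r ≤ ENNReal.ofReal b) : x ≤ ENNReal.ofReal (b ^ r⁻¹) := by
  rw [← ENNReal.ofReal_rpow_of_nonneg hb (inv_nonneg.2 hr.le)]
  calc x = (x ^ r) ^ r⁻¹ := by rw [← ENNReal.rpow_mul, mul_inv_cancel₀ hr.ne', ENNReal.rpow_one]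
    _ ≤ _ := ENNReal.rpow_le_rpow h (inv_nonneg.2 hr.le)

lemma measure_le_of_lorentzNorm_top_le {q W : ℝ} (hq : 0 < q) (hW : 0 ≤ W)
    (h : lorentzNorm μ (ENNReal.ofReal q) ⊤ f Ω ≤ ENNReal.ofReal W) {t : ℝ} (ht : 0 < t) :
    μ {x | x ∈ Ω ∧ t < ‖f x‖} ≤ ENNReal.ofReal ((W / t) ^ q) := by
  unfold lorentzNorm at h
  rw [if_pos rfl] at h
  have h1 := (le_iSup (fun σ : NNReal => (σ : ℝ≥0∞) *
    (μ {x | x ∈ Ω ∧ (σ : ℝ) < ‖f x‖}) ^ (1 / ENNReal.ofReal q).toReal) t.toNNReal).trans h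
  have e : (1 / ENNReal.ofReal q).toReal = q⁻¹ := by
    rw [one_div, ENNReal.toReal_inv, ENNReal.toReal_ofReal hq.le]
  simp only [e, Real.coe_toNNReal t ht.le] at h1
  have h2 : (μ {x | x ∈ Ω ∧ t < ‖f x‖}) ^ q⁻¹ ≤ ENNReal.ofReal (W / t) := by
    rw [ENNReal.ofReal_div_of_pos ht, ENNReal.le_div_iff_mul_le (by simp [ht]) (by simp), mul_comm]
    exact h1
  simpa using le_ofReal_rpow_of_rpow_le (by positivity) (inv_pos.2 hq) h2

lemma lintegral_le_of_lorentzNorm_le {q W : ℝ} {ℓ : ℝ≥0∞} (hq : 0 < q) (hW : 0 ≤ W)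
    (hℓ : 0 < ℓ.toReal)
    (h : lorentzNorm μ (ENNReal.ofReal q) ℓ f Ω ≤ ENNReal.ofReal W) :
    ∫⁻ σ in Set.Ioi (0 : ℝ), ENNReal.ofReal (σ ^ (ℓ.toReal - 1)) *
      (μ {x | x ∈ Ω ∧ σ < ‖f x‖}) ^ (ℓ.toReal / q) ≤ ENNReal.ofReal (W ^ ℓ.toReal) := by
  have hℓt : ℓ ≠ ⊤ := by
    rintro rfl
    simp at hℓ
  unfold lorentzNorm at h
  rw [if_neg hℓt] at h
  have e : (1 / ℓ).toReal = ℓ.toReal⁻¹ := by rw [one_div, ENNReal.toReal_inv]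
  have e2 : (ℓ / ENNReal.ofReal q).toReal = ℓ.toReal / q := by
    rw [ENNReal.toReal_div, ENNReal.toReal_ofReal hq.le]
  rw [e, e2] at h
  simpa using le_ofReal_rpow_of_rpow_le hW (inv_pos.2 hℓ) h

lemma measure_le_of_lorentzNorm_le {q W : ℝ} {ℓ : ℝ≥0∞} (hq : 0 < q) (hW : 0 ≤ W)
    (hℓ : 0 < ℓ.toReal)
    (h : lorentzNorm μ (ENNReal.ofReal q) ℓ f Ω ≤ ENNReal.ofReal W) {t : ℝ} (ht : 0 < t) :
    μ {x | x ∈ Ω ∧ t < ‖f x‖} ≤ ENNReal.ofReal ((ℓ.toReal ^ ℓ.toReal⁻¹ * W / t) ^ q) := by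
  have h0 := lintegral_le_of_lorentzNorm_le hq hW hℓ h
  set l := ℓ.toReal with hl
  have h1 : ENNReal.ofReal (t ^ l / l) * (μ {x | x ∈ Ω ∧ t < ‖f x‖}) ^ (l / q) ≤
      ENNReal.ofReal (W ^ l) := by
    refine le_trans ?_ h0
    calc _ = ∫⁻ σ in Set.Ioc 0 t, ENNReal.ofReal (σ ^ (l - 1)) *
            (μ {x | x ∈ Ω ∧ t < ‖f x‖}) ^ (l / q) := by
          rw [lintegral_mul_const _ (by fun_prop), lintegral_Ioc_rpow (by linarith) ht,
            sub_add_cancel]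
      _ ≤ ∫⁻ σ in Set.Ioc 0 t, ENNReal.ofReal (σ ^ (l - 1)) *
            (μ {x | x ∈ Ω ∧ σ < ‖f x‖}) ^ (l / q) := by
          refine setLIntegral_mono' measurableSet_Ioc fun σ hσ => ?_
          gcongr
          exact hσ.2
      _ ≤ _ := lintegral_mono_set Set.Ioc_subset_Ioi_self
  have h2 : (μ {x | x ∈ Ω ∧ t < ‖f x‖}) ^ (l / q) ≤ ENNReal.ofReal (W ^ l / (t ^ l / l)) := by
    have hp : 0 < t ^ l / l := by positivity
    rw [ENNReal.ofReal_div_of_pos hp, ENNReal.le_div_iff_mul_le (by simp [hp]) (by simp), mul_comm]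
    exact h1
  refine (le_ofReal_rpow_of_rpow_le (by positivity) (div_pos hℓ hq) h2).trans_eq ?_
  congr 1
  have e : W ^ l / (t ^ l / l) = (l ^ l⁻¹ * W / t) ^ l := by
    rw [Real.div_rpow (by positivity) ht.le, Real.mul_rpow (by positivity) hW,
      ← Real.rpow_mul hℓ.le, inv_mul_cancel₀ hℓ.ne', Real.rpow_one]
    field_simp
  rw [e, ← Real.rpow_mul (by positivity)]
  congr 1
  field_simp

lemma lintegral_norm_cube_eq (hf : AEMeasurable (fun x => ‖f x‖) (μ.restrict Ω))
    (hΩ : MeasurableSet Ω) :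
    ∫⁻ x in Ω, ENNReal.ofReal (‖f x‖ ^ (3 : ℝ)) ∂μ =
      ENNReal.ofReal 3 * ∫⁻ t in Set.Ioi (0 : ℝ),
        μ {x | x ∈ Ω ∧ t < ‖f x‖} * ENNReal.ofReal (t ^ (2 : ℝ)) := by
  rw [lintegral_rpow_eq_lintegral_meas_lt_mul _ (Eventually.of_forall fun x => norm_nonneg _) hf
    (by norm_num : (0 : ℝ) < 3)]
  congr 1
  refine lintegral_congr fun t => ?_
  rw [Measure.restrict_apply' hΩ, Set.inter_comm]
  norm_num
  rfl

lemma lintegral_norm_cube_le (hf : AEMeasurable (fun x => ‖f x‖) (μ.restrict Ω))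
    (hΩ : MeasurableSet Ω) {q V Y S : ℝ} (hq : 3 < q) (hV0 : 0 ≤ V) (hV : μ Ω ≤ ENNReal.ofReal V)
    (hY : 0 ≤ Y) (hS : 0 < S)
    (h : ∀ t, 0 < t → μ {x | x ∈ Ω ∧ t < ‖f x‖} ≤ ENNReal.ofReal ((Y / t) ^ q)) :
    ∫⁻ x in Ω, ENNReal.ofReal (‖f x‖ ^ (3 : ℝ)) ∂μ ≤
      ENNReal.ofReal (V * S ^ (3 : ℝ) + 3 / (q - 3) * (Y ^ q * S ^ (3 - q))) := by
  have hq3 : 0 < q - 3 := by linarith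
  rw [lintegral_norm_cube_eq hf hΩ, ← Set.Ioc_union_Ioi_eq_Ioi hS.le,
    lintegral_union measurableSet_Ioi (Set.Ioc_disjoint_Ioi le_rfl)]
  have h1 : ∫⁻ t in Set.Ioc 0 S, μ {x | x ∈ Ω ∧ t < ‖f x‖} * ENNReal.ofReal (t ^ (2 : ℝ)) ≤
      ENNReal.ofReal (V * (S ^ (3 : ℝ) / 3)) := by
    calc _ ≤ ∫⁻ t in Set.Ioc 0 S, ENNReal.ofReal V * ENNReal.ofReal (t ^ (2 : ℝ)) := by
          refine lintegral_mono fun t => ?_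
          gcongr
          exact (measure_mono fun x hx => hx.1).trans hV
      _ = _ := by
          rw [lintegral_const_mul _ (by fun_prop), lintegral_Ioc_rpow (by norm_num) hS,
            ENNReal.ofReal_mul hV0]
          norm_num
  have h2 : ∫⁻ t in Set.Ioi S, μ {x | x ∈ Ω ∧ t < ‖f x‖} * ENNReal.ofReal (t ^ (2 : ℝ)) ≤
      ENNReal.ofReal (Y ^ q * (S ^ (3 - q) / (q - 3))) := by
    calc _ ≤ ∫⁻ t in Set.Ioi S, ENNReal.ofReal (Y ^ q) * ENNReal.ofReal (t ^ (2 - q)) := by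
          refine setLIntegral_mono' measurableSet_Ioi fun t ht => ?_
          have ht0 : 0 < t := hS.trans ht
          rw [← ENNReal.ofReal_mul (by positivity)]
          refine (mul_le_mul_left (h t ht0) _).trans_eq ?_
          rw [← ENNReal.ofReal_mul (by positivity), Real.div_rpow hY ht0.le, Real.rpow_sub ht0]
          congr 1
          ring
      _ = _ := by
          rw [lintegral_const_mul _ (by fun_prop), lintegral_Ioi_rpow (by linarith) hS,
            ENNReal.ofReal_mul (by positivity)]
          congr 2
          rw [neg_div, ← div_neg]
          ring_nf
  refine (mul_le_mul_right (add_le_add h1 h2) _).trans_eq ?_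
  rw [← ENNReal.ofReal_add (by positivity) (by positivity), ← ENNReal.ofReal_mul (by norm_num)]
  congr 1
  field_simp

end Lorentz

lemma volume_ann_le {R : ℝ} (hR : 0 < R) :
    volume (ann R) ≤ ENNReal.ofReal (volume.real (ball (0 : E3) 1) * R ^ (3 : ℝ)) := by
  refine (measure_mono Set.sdiff_subset).trans_eq ?_
  rw [Measure.addHaar_ball _ _ hR.le, mul_comm, ENNReal.ofReal_mul (by positivity),
    ofReal_measureReal measure_ball_lt_top.ne]
  simp

lemma exists_lintegral_cube_le (q : ℝ) (ℓ : ℝ≥0∞) (h : (3 < q ∧ 3 ≤ ℓ) ∨ (q = 3 ∧ ℓ = 3)) :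
    ∃ K : ℝ, 0 < K ∧ ∀ u : E3 → E3, Continuous u → ∀ R m : ℝ, 0 < R → 0 < m →
      ENNReal.ofReal (R ^ (2 / 3 - 3 / q)) *
        lorentzNorm volume (ENNReal.ofReal q) ℓ u (ann R) ≤ ENNReal.ofReal m →
      ∫⁻ x in ann R, ENNReal.ofReal (‖u x‖ ^ (3 : ℝ)) ≤ ENNReal.ofReal (K * R * m ^ 3) := by
  have key : ∀ {N : ℝ≥0∞} {R m : ℝ}, 0 < R → ENNReal.ofReal (R ^ (2 / 3 - 3 / q)) * N ≤
      ENNReal.ofReal m → N ≤ ENNReal.ofReal (m * R ^ (3 / q - 2 / 3)) := fun {N R m} hR hN => by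
    have hp : 0 < R ^ (2 / 3 - 3 / q) := Real.rpow_pos_of_pos hR _
    have e : R ^ (3 / q - 2 / 3) = (R ^ (2 / 3 - 3 / q))⁻¹ := by
      rw [← Real.rpow_neg hR.le, neg_sub]
    rw [e, ← div_eq_mul_inv, ENNReal.ofReal_div_of_pos hp,
      ENNReal.le_div_iff_mul_le (by simp [hp]) (by simp), mul_comm]
    exact hN
  rcases h with ⟨hq, hℓ⟩ | ⟨rfl, rfl⟩
  · have weak : ∃ c : ℝ, 0 < c ∧ ∀ (u : E3 → E3) (R W : ℝ), 0 ≤ W →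
        lorentzNorm volume (ENNReal.ofReal q) ℓ u (ann R) ≤ ENNReal.ofReal W → ∀ t, 0 < t →
          volume {x | x ∈ ann R ∧ t < ‖u x‖} ≤ ENNReal.ofReal ((c * W / t) ^ q) := by
      by_cases hℓt : ℓ = ⊤
      · subst hℓt
        refine ⟨1, one_pos, fun u R W hW h t ht => ?_⟩
        rw [one_mul]
        exact measure_le_of_lorentzNorm_top_le (by linarith) hW h ht
      · have hl : 0 < ℓ.toReal :=
          ENNReal.toReal_pos (fun h0 => by simp [h0] at hℓ) hℓt
        exact ⟨ℓ.toReal ^ ℓ.toReal⁻¹, by positivity, fun u R W hW h t ht =>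
          measure_le_of_lorentzNorm_le (by linarith) hW hl h ht⟩
    obtain ⟨c, c0, hc⟩ := weak
    have hq3 : 0 < q - 3 := by linarith
    refine ⟨volume.real (ball (0 : E3) 1) + 3 / (q - 3) * c ^ q, by positivity,
      fun u hu R m hR hm h => ?_⟩
    have hW : 0 ≤ m * R ^ (3 / q - 2 / 3) := by positivity
    refine (lintegral_norm_cube_le hu.norm.aemeasurable (measurableSet_ann R) hq (by positivity)
      (volume_ann_le hR) (by positivity) (S := m * R ^ (-(2 / 3) : ℝ)) (by positivity)
      (hc u R _ hW (key hR h))).trans_eq ?_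
    congr 1
    have e1 : R ^ (3 : ℝ) * (m * R ^ (-(2 / 3) : ℝ)) ^ (3 : ℝ) = R * m ^ 3 := by
      rw [Real.mul_rpow hm.le (by positivity), ← Real.rpow_mul hR.le, mul_left_comm,
        ← Real.rpow_add hR]
      norm_num
      ring
    have e2 : (m * R ^ (3 / q - 2 / 3)) ^ q * (m * R ^ (-(2 / 3) : ℝ)) ^ (3 - q) = R * m ^ 3 := by
      rw [Real.mul_rpow hm.le (by positivity), Real.mul_rpow hm.le (by positivity),
        ← Real.rpow_mul hR.le, ← Real.rpow_mul hR.le]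
      calc _ = (m ^ q * m ^ (3 - q)) * (R ^ ((3 / q - 2 / 3) * q) * R ^ (-(2 / 3) * (3 - q))) := by
            ring
        _ = m ^ (3 : ℝ) * R ^ (1 : ℝ) := by
            rw [← Real.rpow_add hm, ← Real.rpow_add hR]
            congr 2
            · ring
            · field_simp
              ring
        _ = _ := by
            rw [Real.rpow_one]
            norm_cast
            ring
    rw [Real.mul_rpow c0.le hW, mul_assoc (c ^ q), e2, mul_assoc (volume.real _), e1]
    ring
  · refine ⟨3, by norm_num, fun u hu R m hR hm h => ?_⟩
    have h1 := lintegral_le_of_lorentzNorm_le (by norm_num) (by positivity) (by norm_num)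
      (key hR h)
    rw [lintegral_norm_cube_eq hu.norm.aemeasurable (measurableSet_ann R)]
    have e : (m * R ^ (3 / 3 - 2 / 3 : ℝ)) ^ (3 : ℝ≥0∞).toReal = R * m ^ 3 := by
      rw [show (3 : ℝ≥0∞).toReal = 3 from rfl, Real.mul_rpow hm.le (by positivity),
        ← Real.rpow_mul hR.le]
      norm_num
      ring
    rw [e] at h1
    rw [mul_assoc, ENNReal.ofReal_mul (by norm_num)]
    gcongr
    refine le_trans (le_of_eq (lintegral_congr fun t => ?_)) h1
    rw [show (3 : ℝ≥0∞).toReal = 3 from rfl, mul_comm]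
    norm_num

lemma energy_le_of_frequently {w : E3 → ℝ≥0∞} {A B : ℝ}
    (h : ∃ᶠ R : ℝ in atTop, ∫⁻ x in ball 0 (R / 2), w x ≤
      ENNReal.ofReal (A * R ^ (-(1 / 3) : ℝ) + B)) : ∫⁻ x, w x ≤ ENNReal.ofReal B := by
  have ht : Tendsto (fun R : ℝ => ENNReal.ofReal (A * R ^ (-(1 / 3) : ℝ) + B)) atTop
      (nhds (ENNReal.ofReal B)) := by
    refine ENNReal.tendsto_ofReal ?_
    simpa using ((tendsto_rpow_neg_atTop (by norm_num : (0 : ℝ) < 1 / 3)).const_mul A).add_const B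
  have hb : ∀ n : ℕ, ∫⁻ x in ball 0 n, w x ≤ ENNReal.ofReal B := fun n => by
    refine ge_of_tendsto_of_frequently ht ?_
    refine (h.and_eventually (eventually_ge_atTop (2 * n : ℝ))).mono fun R hR => ?_
    exact (lintegral_mono_set (ball_subset_ball (by linarith [hR.2]))).trans hR.1
  rw [← setLIntegral_univ, ← iUnion_ball_nat (0 : E3), setLIntegral_iUnion_of_directed]
  · exact iSup_le hb
  · refine Monotone.directed_le fun m n hmn => ball_subset_ball ?_
    exact_mod_cast hmn

theorem stmt_10 (q : ℝ) (ℓ : ℝ≥0∞)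
    (h : (3 < q ∧ 3 ≤ ℓ) ∨ (q = 3 ∧ ℓ = 3)) :
    ∃ c : ℝ≥0∞, 0 < c ∧ c < ⊤ ∧
      ∀ (u : E3 → E3) (p : E3 → ℝ), ContDiff ℝ (⊤ : ℕ∞) u → ContDiff ℝ (⊤ : ℕ∞) p → SteadyNS u p →
        (liminf (fun R : ℝ =>
            ENNReal.ofReal (R ^ (2 / 3 - 3 / q)) *
              lorentzNorm volume (ENNReal.ofReal q) ℓ u (ann R)) atTop < ⊤) →
        (∫⁻ x, ENNReal.ofReal (‖fderiv ℝ u x‖ ^ 2)) ≤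
          c * (liminf (fun R : ℝ =>
            ENNReal.ofReal (R ^ (2 / 3 - 3 / q)) *
              lorentzNorm volume (ENNReal.ofReal q) ℓ u (ann R)) atTop) ^ 3 := by
  obtain ⟨K₁, hK₁, energy⟩ := exists_lintegral_energy_bound
  obtain ⟨K₂, hK₂, cube⟩ := exists_lintegral_cube_le q ℓ h
  refine ⟨ENNReal.ofReal (K₁ * K₂), by simp; positivity, ENNReal.ofReal_lt_top,
    fun u p hu hp hns hfin => ?_⟩
  set L := liminf (fun R : ℝ => ENNReal.ofReal (R ^ (2 / 3 - 3 / q)) *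
    lorentzNorm volume (ENNReal.ofReal q) ℓ u (ann R)) atTop with hL
  have bound : ∀ ε : ℝ, 0 < ε → ∫⁻ x, ENNReal.ofReal (‖fderiv ℝ u x‖ ^ 2) ≤
      ENNReal.ofReal (K₁ * K₂ * (L.toReal + ε) ^ 3) := fun ε hε => by
    set m := L.toReal + ε with hm
    have m0 : 0 < m := by positivity
    have hLm : L < ENNReal.ofReal m := (ENNReal.lt_ofReal_iff_toReal_lt hfin.ne).2 (by linarith)
    refine energy_le_of_frequently (A := K₁ * (K₂ * m ^ 3) ^ (2 / 3 : ℝ)) ?_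
    refine ((frequently_lt_of_liminf_lt (by isBoundedDefault) hLm).and_eventually
      (eventually_gt_atTop 0)).mono fun R hR => ?_
    have R0 := hR.2
    have hc := cube u hu.continuous R m R0 m0 hR.1.le
    have a0 : 0 < (K₂ * m ^ 3) * R := by positivity
    have a3 : (((K₂ * m ^ 3) * R) ^ (1 / 3 : ℝ)) ^ 3 = K₂ * R * m ^ 3 := by
      rw [← Real.rpow_natCast, ← Real.rpow_mul a0.le]
      norm_num
      ring
    have a2 : (((K₂ * m ^ 3) * R) ^ (1 / 3 : ℝ)) ^ 2 =
        (K₂ * m ^ 3) ^ (2 / 3 : ℝ) * R ^ (2 / 3 : ℝ) := by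
      rw [← Real.rpow_natCast, ← Real.rpow_mul a0.le, Real.mul_rpow (by positivity) R0.le]
      norm_num
    refine (energy u p hu hp hns R _ R0 (Real.rpow_pos_of_pos a0 _) (by rwa [a3])).trans_eq ?_
    rw [a2, a3]
    have e : R ^ (-(1 / 3) : ℝ) = R⁻¹ * R ^ (2 / 3 : ℝ) := by
      rw [← Real.rpow_neg_one, ← Real.rpow_add R0]
      norm_num
    rw [e]
    congr 1
    field_simp
  have lim : Tendsto (fun ε : ℝ => ENNReal.ofReal (K₁ * K₂ * (L.toReal + ε) ^ 3))
      (nhdsWithin 0 (Set.Ioi 0)) (nhds (ENNReal.ofReal (K₁ * K₂ * L.toReal ^ 3))) := by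
    refine ENNReal.tendsto_ofReal (tendsto_nhdsWithin_of_tendsto_nhds ?_)
    have : Continuous fun ε : ℝ => K₁ * K₂ * (L.toReal + ε) ^ 3 := by fun_prop
    simpa using this.tendsto 0
  have fin := ge_of_tendsto lim (by
    filter_upwards [self_mem_nhdsWithin] with ε hε using bound ε hε)
  rwa [ENNReal.ofReal_mul (by positivity), ENNReal.ofReal_pow ENNReal.toReal_nonneg,
    ENNReal.ofReal_toReal hfin.ne] at fin
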